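/- Let L = F_{2^n}, let k ≥ 2, let t = 2^{2k} − 2^k + 1 be the Kasami–Welch number, and let f(x) = x^t + h(x) ∈ L[x], where h is a polynomial with 3 ≤ d = deg(h), d ≡ 5 (mod 8), and d < 2^{2k} − 3·2^k − 1. If φ_t(x,y) and φ_d(x,y) have no common nonconstant factor (they are relatively prime), then f is not exceptional APN: there are only finitely many m ≥ 1 such that f is APN on F_{2^{nm}}. -/

import Mathlib

/-- `g` is almost perfect nonlinear (APN) on the field `K`: for all `a ≠ 0` and all `b`,
the equation `g(x+a) + g(x) = b` has at most two solutions. -/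
def IsAPN {K : Type} [Field K] (g : K → K) : Prop :=
  ∀ a b : K, a ≠ 0 → {x : K | g (x + a) + g x = b}.ncard ≤ 2

namespace KW
open Polynomial

/-- A multiplicative filtration of a commutative ring. -/
structure Filt (A : Type*) [CommRing A] where
  W : ℕ → AddSubgroup A
  mono : ∀ {i j : ℕ}, i ≤ j → W i ≤ W j
  one : (1 : A) ∈ W 0
  mul : ∀ {i j : ℕ} {a b : A}, a ∈ W i → b ∈ W j → a * b ∈ W (i + j)

namespace Filt
variable {A : Type*} [CommRing A] (φ : Filt A)

lemma pow {i : ℕ} {a : A} (h : a ∈ φ.W i) (n : ℕ) : a ^ n ∈ φ.W (n * i) := by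
  induction n with
  | zero => simpa using φ.one
  | succ n ih => rw [pow_succ, Nat.succ_mul]; exact φ.mul ih h

/-- The induced filtration on the polynomial ring, the variable having weight one. -/
def poly : Filt A[X] where
  W n :=
    { carrier := {p | (∀ i ≤ n, p.coeff i ∈ φ.W (n - i)) ∧ ∀ i, n < i → p.coeff i = 0}
      zero_mem' := by simp [zero_mem]
      add_mem' := by
        rintro a b ⟨h1, h2⟩ ⟨h3, h4⟩
        refine ⟨fun i hi => ?_, fun i hi => ?_⟩
        · rw [coeff_add]; exact add_mem (h1 i hi) (h3 i hi)
        · rw [coeff_add, h2 i hi, h4 i hi, add_zero]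
      neg_mem' := by
        rintro a ⟨h1, h2⟩
        refine ⟨fun i hi => ?_, fun i hi => ?_⟩
        · rw [coeff_neg]; exact neg_mem (h1 i hi)
        · rw [coeff_neg, h2 i hi, neg_zero] }
  mono := by
    rintro i j hij p ⟨h1, h2⟩
    refine ⟨fun k hk => ?_, fun k hk => h2 k (by omega)⟩
    by_cases h : k ≤ i
    · exact φ.mono (by omega) (h1 k h)
    · rw [h2 k (by omega)]; exact zero_mem _
  one := by
    refine ⟨fun i hi => ?_, fun i hi => ?_⟩
    · obtain rfl : i = 0 := by omega
      simpa using φ.one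
    · rw [coeff_one, if_neg (by omega)]
  mul := by
    rintro n m a b ⟨h1, h2⟩ ⟨h3, h4⟩
    have key : ∀ k : ℕ, ∀ x ∈ Finset.HasAntidiagonal.antidiagonal k, (k ≤ n + m → a.coeff x.1 * b.coeff x.2 ∈ φ.W (n + m - k)) ∧
        (n + m < k → a.coeff x.1 * b.coeff x.2 = 0) := by
      intro k x hx
      rw [Finset.HasAntidiagonal.mem_antidiagonal] at hx
      by_cases ha : x.1 ≤ n
      · by_cases hb : x.2 ≤ m
        · refine ⟨fun _ => ?_, fun h => by omega⟩
          have := φ.mul (h1 _ ha) (h3 _ hb)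
          rwa [show n - x.1 + (m - x.2) = n + m - k by omega] at this
        · rw [h4 _ (by omega), mul_zero]; exact ⟨fun _ => zero_mem _, fun _ => rfl⟩
      · rw [h2 _ (by omega), zero_mul]; exact ⟨fun _ => zero_mem _, fun _ => rfl⟩
    refine ⟨fun i hi => ?_, fun i hi => ?_⟩
    · rw [coeff_mul]; exact sum_mem fun x hx => (key i x hx).1 hi
    · rw [coeff_mul]; exact Finset.sum_eq_zero fun x hx => (key i x hx).2 hi

lemma mem_poly {n : ℕ} {p : A[X]} : p ∈ φ.poly.W n ↔
    (∀ i ≤ n, p.coeff i ∈ φ.W (n - i)) ∧ ∀ i, n < i → p.coeff i = 0 := Iff.rfl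

lemma coeff_mem {n : ℕ} {p : A[X]} (h : p ∈ φ.poly.W n) (i : ℕ) : p.coeff i ∈ φ.W (n - i) := by
  by_cases hi : i ≤ n
  · exact h.1 i hi
  · rw [h.2 i (by omega)]; exact zero_mem _

lemma C_mem {n : ℕ} {a : A} (h : a ∈ φ.W n) : C a ∈ φ.poly.W n := by
  refine ⟨fun i hi => ?_, fun i hi => ?_⟩
  · rw [coeff_C]; split_ifs with h0
    · subst h0; simpa using h
    · exact zero_mem _
  · rw [coeff_C, if_neg (by omega)]

lemma X_mem : (X : A[X]) ∈ φ.poly.W 1 := by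
  refine ⟨fun i hi => ?_, fun i hi => ?_⟩
  · rw [coeff_X]; split_ifs with h0
    · subst h0; simpa using φ.one
    · exact zero_mem _
  · rw [coeff_X, if_neg (by omega)]

lemma X_pow_mem (n : ℕ) : (X ^ n : A[X]) ∈ φ.poly.W n := by
  simpa using φ.poly.pow φ.X_mem n

lemma modByMonic_mem {F : A[X]} (hF : F.Monic) (hW : F ∈ φ.poly.W F.natDegree) {n : ℕ}
    {p : A[X]} (hp : p ∈ φ.poly.W n) : p %ₘ F ∈ φ.poly.W n := by
  nontriviality A
  induction hN : p.degree using WellFoundedLT.induction generalizing p with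
  | ind N ih =>
    by_cases hlt : p.degree < F.degree
    · rwa [(modByMonic_eq_self_iff hF).2 hlt]
    · have hle : F.degree ≤ p.degree := not_lt.1 hlt
      have hp0 : p ≠ 0 := by
        rintro rfl
        rw [degree_zero, le_bot_iff, degree_eq_bot] at hle
        exact hF.ne_zero hle
      have hnd : F.natDegree ≤ p.natDegree := natDegree_le_natDegree hle
      have hNn : p.natDegree ≤ n := by
        by_contra h
        exact hp0 (leadingCoeff_eq_zero.1 (hp.2 _ (by omega)))
      have hlt' := div_wf_lemma ⟨hle, hp0⟩ hF
      set p' := p - F * (C p.leadingCoeff * X ^ (p.natDegree - F.natDegree)) with hp'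
      have hmem : p' ∈ φ.poly.W n := by
        refine sub_mem hp ?_
        have := φ.poly.mul hW (φ.poly.mul (φ.C_mem (hp.1 _ hNn)) (φ.X_pow_mem (p.natDegree - F.natDegree)))
        rwa [show F.natDegree + (n - p.natDegree + (p.natDegree - F.natDegree)) = n by omega] at this
      have := ih p'.degree (hN ▸ hlt') hmem rfl
      have e : p' %ₘ F = p %ₘ F := by
        rw [hp', sub_modByMonic, self_mul_modByMonic hF, sub_zero]
      rwa [e] at this

/-- Coefficients of the quotient by a linear factor. -/
lemma divByMonic_mem {F : A[X]} {D : ℕ} (hW : F ∈ φ.poly.W (D + 1)) (hN : F.natDegree ≤ D + 1) {a : A} (ha : a ∈ φ.W 1) :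
    F /ₘ (X - C a) ∈ φ.poly.W D := by
  have h0 : ∀ i, D < i → (F /ₘ (X - C a)).coeff i = 0 := by
    intro i hi
    rw [coeff_divByMonic_X_sub_C]
    refine Finset.sum_eq_zero fun j hj => ?_
    rw [Finset.mem_Icc] at hj
    omega
  refine ⟨fun i hi => ?_, h0⟩
  obtain ⟨k, rfl⟩ : ∃ k, i = D - k := ⟨D - i, by omega⟩
  clear hi
  induction k with
  | zero =>
    rw [coeff_divByMonic_X_sub_C_rec, h0 (D - 0 + 1) (by omega), mul_zero, add_zero]
    have := φ.coeff_mem hW (D - 0 + 1)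
    exact φ.mono (by omega) this
  | succ k ih =>
    by_cases hk : k < D
    · rw [coeff_divByMonic_X_sub_C_rec]
      refine add_mem (φ.mono (by omega) (φ.coeff_mem hW _)) ?_
      rw [show D - (k + 1) + 1 = D - k by omega]
      exact φ.mono (by omega) (φ.mul ha ih)
    · rwa [show D - (k + 1) = D - k by omega]

end Filt

/-- The filtration by partial degrees on polynomials in two variables. -/
noncomputable def filt (K : Type*) [Field K] : Filt (MvPolynomial (Fin 2) K) where
  W n :=
    { carrier := {p | ∀ j, p.degreeOf j ≤ n}
      zero_mem' := by simp
      add_mem' := by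
        intro a b ha hb j
        exact (MvPolynomial.degreeOf_add_le j a b).trans (max_le (ha j) (hb j))
      neg_mem' := by
        intro a ha j
        rw [MvPolynomial.degreeOf_neg]; exact ha j }
  mono := fun hij p hp j => (hp j).trans hij
  one := fun j => by simp
  mul := fun ha hb j => (MvPolynomial.degreeOf_mul_le j _ _).trans (add_le_add (ha j) (hb j))

lemma mem_filt {K : Type*} [Field K] {n : ℕ} {p : MvPolynomial (Fin 2) K} :
    p ∈ (filt K).W n ↔ ∀ j, p.degreeOf j ≤ n := Iff.rfl

end KW

namespace KW
open Polynomial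

lemma Filt.prod_mem {A : Type*} [CommRing A] (φ : Filt A) {ι : Type*} (s : Finset ι) (f : ι → A)
    (n : ℕ) (h : ∀ i ∈ s, f i ∈ φ.W n) : ∏ i ∈ s, f i ∈ φ.W (s.card * n) := by
  classical
  induction s using Finset.induction_on with
  | empty => simpa using φ.one
  | insert a s ha ih =>
    rw [Finset.prod_insert ha, Finset.card_insert_of_notMem ha, Nat.succ_mul, add_comm]
    exact φ.mul (h a (by simp)) (ih fun i hi => h i (by simp [hi]))

lemma Filt.det_mem {A : Type*} [CommRing A] (φ : Filt A) {ι : Type*} [Fintype ι] [DecidableEq ι]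
    (M : Matrix ι ι A) (n : ℕ) (h : ∀ i j, M i j ∈ φ.W n) : M.det ∈ φ.W (Fintype.card ι * n) := by
  rw [Matrix.det_apply]
  refine sum_mem fun σ _ => ?_
  rw [Units.smul_def]
  exact zsmul_mem (φ.prod_mem Finset.univ _ n fun i _ => h _ _) _

section
variable {Ω : Type*} [Field Ω]

lemma X_add_C_mem (x : Ω) (i j : Fin 2) :
    (MvPolynomial.X i + MvPolynomial.C x : MvPolynomial (Fin 2) Ω).degreeOf j ≤
      if i = j then 1 else 0 := by
  refine (MvPolynomial.degreeOf_add_le _ _ _).trans ?_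
  rw [MvPolynomial.degreeOf_C, MvPolynomial.degreeOf_X]
  split_ifs with h1 h2 <;> simp_all

/-- Translation. -/
noncomputable def transl (x : Fin 2 → Ω) : MvPolynomial (Fin 2) Ω →ₐ[Ω] MvPolynomial (Fin 2) Ω :=
  MvPolynomial.aeval fun i => MvPolynomial.X i + MvPolynomial.C (x i)

lemma transl_transl (x : Fin 2 → Ω) (p : MvPolynomial (Fin 2) Ω) :
    transl (-x) (transl x p) = p := by
  have : (transl (-x)).comp (transl x) = AlgHom.id Ω _ := by
    apply MvPolynomial.algHom_ext
    intro i
    simp [transl]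
  exact DFunLike.congr_fun this p

lemma transl_mem (x : Fin 2 → Ω) {n : ℕ} {p : MvPolynomial (Fin 2) Ω} (h : p ∈ (filt Ω).W n) :
    transl x p ∈ (filt Ω).W n := by
  rw [MvPolynomial.as_sum p, map_sum]
  refine sum_mem fun m hm => ?_
  intro j
  have hmj : m j ≤ n := (MvPolynomial.degreeOf_le_iff.1 (h j)) m hm
  refine le_trans ?_ hmj
  rw [transl, MvPolynomial.aeval_monomial, MvPolynomial.algebraMap_eq]
  refine (MvPolynomial.degreeOf_C_mul_le _ _ _).trans ?_
  rw [Finsupp.prod_fintype _ _ (by simp)]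
  refine (MvPolynomial.degreeOf_prod_le _ _ _).trans ?_
  calc ∑ i, MvPolynomial.degreeOf j ((MvPolynomial.X i + MvPolynomial.C (x i) :
          MvPolynomial (Fin 2) Ω) ^ m i) ≤ ∑ i, m i * (if i = j then 1 else 0) := by
        refine Finset.sum_le_sum fun i _ => ?_
        exact (MvPolynomial.degreeOf_pow_le _ _ _).trans (Nat.mul_le_mul_left _ (X_add_C_mem _ _ _))
    _ = m j := by simp

lemma eval_eq_constantCoeff_transl (x : Fin 2 → Ω) (p : MvPolynomial (Fin 2) Ω) :
    MvPolynomial.constantCoeff (transl x p) = MvPolynomial.eval x p := by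
  have : (MvPolynomial.constantCoeff).comp (transl x).toRingHom = MvPolynomial.eval x := by
    apply MvPolynomial.ringHom_ext <;> intro i <;> simp [transl]
  exact DFunLike.congr_fun this p

lemma eq_zero_of_mem_pow {Q N : ℕ} (hNQ : N < Q) {p : MvPolynomial (Fin 2) Ω}
    (hp : p ∈ (filt Ω).W N)
    (h : p ∈ Ideal.span {(MvPolynomial.X 0 : MvPolynomial (Fin 2) Ω) ^ Q, MvPolynomial.X 1 ^ Q}) :
    p = 0 := by
  have e : ({(MvPolynomial.X 0 : MvPolynomial (Fin 2) Ω) ^ Q, MvPolynomial.X 1 ^ Q} : Set _) =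
      (fun s => (MvPolynomial.monomial s) (1 : Ω)) '' {Finsupp.single 0 Q, Finsupp.single 1 Q} := by
    rw [Set.image_pair, MvPolynomial.X_pow_eq_monomial, MvPolynomial.X_pow_eq_monomial]
  rw [e, MvPolynomial.mem_ideal_span_monomial_image] at h
  by_contra h0
  obtain ⟨m, hm⟩ := MvPolynomial.support_nonempty.2 h0
  obtain ⟨s, hs, hsm⟩ := h m hm
  rcases hs with rfl | rfl
  · have := hsm 0
    have h2 := (MvPolynomial.degreeOf_le_iff.1 (hp 0)) m hm
    simp at this; omega
  · have := hsm 1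
    have h2 := (MvPolynomial.degreeOf_le_iff.1 (hp 1)) m hm
    simp at this; omega

/-- the ideal of `Q`-th powers at a point -/
noncomputable def ptIdeal (x : Fin 2 → Ω) (Q : ℕ) : Ideal (MvPolynomial (Fin 2) Ω) :=
  Ideal.span {(MvPolynomial.X 0 - MvPolynomial.C (x 0)) ^ Q,
    (MvPolynomial.X 1 - MvPolynomial.C (x 1)) ^ Q}

lemma eq_zero_of_mem_ptIdeal {Q N : ℕ} (hNQ : N < Q) {p : MvPolynomial (Fin 2) Ω} (x : Fin 2 → Ω)
    (hp : p ∈ (filt Ω).W N) (h : p ∈ ptIdeal x Q) : p = 0 := by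
  have h1 := Ideal.mem_map_of_mem (transl x) h
  rw [ptIdeal, Ideal.map_span, Set.image_pair] at h1
  have : transl x p = 0 := by
    apply eq_zero_of_mem_pow hNQ (transl_mem x hp)
    simpa [transl] using h1
  rw [← transl_transl x p, this, map_zero]

lemma pow_mem_ptIdeal [CharP Ω 2] (j : ℕ) {p : MvPolynomial (Fin 2) Ω} (x : Fin 2 → Ω)
    (h : MvPolynomial.eval x p = 0) : p ^ (2 ^ j) ∈ ptIdeal x (2 ^ j) := by
  have h1 : transl x p ∈ Ideal.span (MvPolynomial.X '' (Set.univ : Set (Fin 2))) := by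
    rw [MvPolynomial.mem_ideal_span_X_image]
    intro m hm
    by_contra! h2
    have : m = 0 := by ext i; exact h2 i (Set.mem_univ _)
    subst this
    rw [← eval_eq_constantCoeff_transl] at h
    exact (MvPolynomial.mem_support_iff.1 hm) h
  have h2 := Ideal.mem_map_of_mem (transl (-x)) h1
  rw [transl_transl, Ideal.map_span] at h2
  have e : (transl (-x)) '' (MvPolynomial.X '' (Set.univ : Set (Fin 2))) =
     {(MvPolynomial.X 0 - MvPolynomial.C (x 0)), (MvPolynomial.X 1 - MvPolynomial.C (x 1))} := by
    have : (Set.univ : Set (Fin 2)) = {0, 1} := by ext i; fin_cases i <;> simp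
    rw [this, Set.image_pair, Set.image_pair]
    simp [transl, sub_eq_add_neg]
  rw [e, Ideal.mem_span_pair] at h2
  obtain ⟨a, b, rfl⟩ := h2
  rw [add_pow_char_pow, mul_pow, mul_pow]
  refine add_mem (Ideal.mul_mem_left _ _ (Ideal.subset_span (by simp))) (Ideal.mul_mem_left _ _ (Ideal.subset_span (by simp)))

lemma eval_norm_eq_zero {F : (MvPolynomial (Fin 2) Ω)[X]} (hF : F.Monic) (x : Fin 2 → Ω) (y : Ω)
    (hy : eval₂ (MvPolynomial.eval x) y F = 0) (hD : 0 < F.natDegree)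
    (p : (MvPolynomial (Fin 2) Ω)[X]) (hp : eval₂ (MvPolynomial.eval x) y p = 0) :
    MvPolynomial.eval x (Algebra.leftMulMatrix (AdjoinRoot.powerBasisAux' hF) (AdjoinRoot.mk F p)).det = 0 := by
  set b := AdjoinRoot.powerBasisAux' hF
  let θ : AdjoinRoot F →+* Ω := AdjoinRoot.lift (MvPolynomial.eval x) y hy
  rw [RingHom.map_det, ← Matrix.exists_vecMul_eq_zero_iff]
  refine ⟨fun i => θ (b i), ?_, ?_⟩
  · intro h0
    have h1 := b.sum_repr 1
    have h2 := congrArg θ h1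
    rw [map_sum, map_one θ] at h2
    rw [Finset.sum_eq_zero] at h2
    · exact zero_ne_one h2
    · intro i _
      rw [Algebra.smul_def, map_mul, congrFun h0 i]; simp
  · funext j
    simp only [Matrix.vecMul, dotProduct, RingHom.mapMatrix_apply, Matrix.map_apply,
      Algebra.leftMulMatrix_eq_repr_mul, Pi.zero_apply]
    have h2 := congrArg θ (b.sum_repr (AdjoinRoot.mk F p * b j))
    rw [map_sum, map_mul θ] at h2
    have h3 : θ (AdjoinRoot.mk F p) = 0 := by
      rw [AdjoinRoot.lift_mk]; exact hp
    rw [h3, zero_mul] at h2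
    rw [← h2]
    refine Finset.sum_congr rfl fun i _ => ?_
    rw [Algebra.smul_def, map_mul θ, mul_comm, AdjoinRoot.algebraMap_eq, AdjoinRoot.lift_of]

/-- Local vanishing lemma. -/
lemma local_vanish [CharP Ω 2] {F w : (MvPolynomial (Fin 2) Ω)[X]} (hF : F.Monic)
    (hirr : Irreducible F) (hD : 0 < F.natDegree)
    (hW : F ∈ (filt Ω).poly.W F.natDegree) {n j : ℕ} (hw : w ∈ (filt Ω).poly.W n)
    (hdeg : w.degree < F.degree)
    (hQ : F.natDegree * (n + F.natDegree) < 2 ^ j) (x : Fin 2 → Ω) (y : Ω)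
    (hy : eval₂ (MvPolynomial.eval x) y F = 0)
    (r0 r1 r2 : (MvPolynomial (Fin 2) Ω)[X])
    (hr : F ∣ w - (C ((MvPolynomial.X 0 - MvPolynomial.C (x 0)) ^ 2 ^ j) * r0 +
      C ((MvPolynomial.X 1 - MvPolynomial.C (x 1)) ^ 2 ^ j) * r1 +
      (X - C (MvPolynomial.C y)) ^ 2 ^ j * r2)) : w = 0 := by
  have : IsDomain (AdjoinRoot F) := AdjoinRoot.isDomain_of_prime hirr.prime
  set b := AdjoinRoot.powerBasisAux' hF with hb
  set T := Algebra.leftMulMatrix b with hT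
  -- degree bound
  have hdet : (T (AdjoinRoot.mk F w)).det ∈ (filt Ω).W (F.natDegree * (n + F.natDegree)) := by
    have := (filt Ω).det_mem (T (AdjoinRoot.mk F w)) (n + F.natDegree) ?_
    · simpa using this
    intro i j
    have hbj : b j = AdjoinRoot.mk F (X ^ (j : ℕ)) := by
      have := (AdjoinRoot.powerBasis' hF).basis_eq_pow j
      rw [AdjoinRoot.powerBasis'_gen, ← AdjoinRoot.mk_X, ← map_pow] at this
      exact this
    rw [hT, Algebra.leftMulMatrix_eq_repr_mul, hbj, ← map_mul, hb,
      AdjoinRoot.powerBasisAux'_repr_apply_to_fun, AdjoinRoot.modByMonicHom_mk]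
    have h1 := (filt Ω).poly.mul hw ((filt Ω).X_pow_mem (j : ℕ))
    have h2 := (filt Ω).modByMonic_mem hF hW h1
    exact (filt Ω).mono (by omega) ((filt Ω).coeff_mem h2 i)
  have hmem : (T (AdjoinRoot.mk F w)).det ∈ ptIdeal x (2 ^ j) := by
    have e : AdjoinRoot.mk F w = algebraMap (MvPolynomial (Fin 2) Ω) (AdjoinRoot F) ((MvPolynomial.X 0 - MvPolynomial.C (x 0)) ^ 2 ^ j) * AdjoinRoot.mk F r0
      + algebraMap (MvPolynomial (Fin 2) Ω) (AdjoinRoot F) ((MvPolynomial.X 1 - MvPolynomial.C (x 1)) ^ 2 ^ j) * AdjoinRoot.mk F r1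
      + (AdjoinRoot.mk F (X - C (MvPolynomial.C y))) ^ 2 ^ j * AdjoinRoot.mk F r2 := by
      rw [← AdjoinRoot.mk_eq_zero, map_sub, sub_eq_zero] at hr
      rw [hr]
      simp only [map_add, map_mul, map_pow, AdjoinRoot.algebraMap_eq, AdjoinRoot.mk_C]
    rw [← Ideal.Quotient.eq_zero_iff_mem, RingHom.map_det, e]
    have z0 : Ideal.Quotient.mk (ptIdeal x (2 ^ j)) ((MvPolynomial.X 0 - MvPolynomial.C (x 0)) ^ 2 ^ j) = 0 :=
      Ideal.Quotient.eq_zero_iff_mem.2 (Ideal.subset_span (by simp))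
    have z1 : Ideal.Quotient.mk (ptIdeal x (2 ^ j)) ((MvPolynomial.X 1 - MvPolynomial.C (x 1)) ^ 2 ^ j) = 0 :=
      Ideal.Quotient.eq_zero_iff_mem.2 (Ideal.subset_span (by simp))
    have key : ∀ a r, Ideal.Quotient.mk (ptIdeal x (2 ^ j)) a = 0 →
        (Ideal.Quotient.mk (ptIdeal x (2 ^ j))).mapMatrix (T (algebraMap _ (AdjoinRoot F) a * r)) = 0 := by
      intro a r ha
      ext i i'
      rw [← Algebra.smul_def, map_smul, RingHom.mapMatrix_apply, Matrix.map_apply, Matrix.smul_apply,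
        smul_eq_mul, map_mul, ha, zero_mul, Matrix.zero_apply]
    rw [map_add, map_add, map_add, map_add, key _ _ z0, key _ _ z1, zero_add, zero_add,
      ← RingHom.map_det, map_mul, Matrix.det_mul, map_pow, Matrix.det_pow, map_mul]
    have h0 : MvPolynomial.eval x (T (AdjoinRoot.mk F (X - C (MvPolynomial.C y)))).det = 0 :=
      eval_norm_eq_zero hF x y hy hD _ (by simp)
    rw [Ideal.Quotient.eq_zero_iff_mem.2 (pow_mem_ptIdeal j x h0), zero_mul]
  have h0 := eq_zero_of_mem_ptIdeal hQ x hdet hmem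
  rw [← Algebra.norm_eq_matrix_det, Algebra.norm_eq_zero_iff_of_basis b, AdjoinRoot.mk_eq_zero] at h0
  exact eq_zero_of_dvd_of_degree_lt h0 hdeg
end
end KW

namespace KW
open Polynomial

/-- Index type of box monomials. -/
abbrev Idx (m D : ℕ) := Fin m × Fin m × Fin D

section
variable {Ω : Type*} [Field Ω]

/-- Two-variable monomial. -/
noncomputable def mono2 (Ω : Type*) [Field Ω] (a b : ℕ) : MvPolynomial (Fin 2) Ω :=
  MvPolynomial.monomial (Finsupp.single 0 a + Finsupp.single 1 b) 1

lemma mono2_eq (a b : ℕ) : mono2 Ω a b = MvPolynomial.X 0 ^ a * MvPolynomial.X 1 ^ b := by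
  rw [mono2, MvPolynomial.X_pow_eq_monomial, MvPolynomial.X_pow_eq_monomial,
    MvPolynomial.monomial_mul, one_mul]

lemma fs_eq_iff (a b a' b' : ℕ) : (Finsupp.single (0 : Fin 2) a + Finsupp.single 1 b =
    Finsupp.single (0 : Fin 2) a' + Finsupp.single 1 b') ↔ a = a' ∧ b = b' := by
  constructor
  · intro h
    have h0 := DFunLike.congr_fun h 0
    have h1 := DFunLike.congr_fun h 1
    simpa using And.intro h0 h1
  · rintro ⟨rfl, rfl⟩; rfl

lemma coeff_C_mul_mono2 (u : Ω) (a b a' b' : ℕ) :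
    MvPolynomial.coeff (Finsupp.single 0 a + Finsupp.single 1 b)
      (MvPolynomial.C u * mono2 Ω a' b') = if a' = a ∧ b' = b then u else 0 := by
  rw [mono2, MvPolynomial.C_mul_monomial, MvPolynomial.coeff_monomial, mul_one]
  simp only [fs_eq_iff]

lemma mono2_mem {a b n : ℕ} (ha : a ≤ n) (hb : b ≤ n) : mono2 Ω a b ∈ (filt Ω).W n := by
  intro j
  rw [mono2, MvPolynomial.degreeOf_monomial_eq _ _ one_ne_zero]
  fin_cases j <;> simp [ha, hb]

lemma Cmem (u : Ω) (n : ℕ) : MvPolynomial.C u ∈ (filt Ω).W n := by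
  intro j; simp

/-- The Stepanov auxiliary polynomial. -/
noncomputable def bigB (Q : ℕ) {m l D : ℕ} (κ : Idx m D → Idx l D → Ω) :
    (MvPolynomial (Fin 2) Ω)[X] :=
  ∑ a, ∑ c, C (MvPolynomial.C (κ a c) * mono2 Ω (Q * a.1 + c.1) (Q * a.2.1 + c.2.1)) *
    X ^ (Q * a.2.2 + c.2.2 : ℕ)

/-- small part -/
noncomputable def smallw {l D : ℕ} (u : Idx l D → Ω) : (MvPolynomial (Fin 2) Ω)[X] :=
  ∑ c, C (MvPolynomial.C (u c) * mono2 Ω c.1 c.2.1) * X ^ (c.2.2 : ℕ)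

lemma smallw_coeff {l D : ℕ} (u : Idx l D → Ω) (c : Idx l D) :
    MvPolynomial.coeff (Finsupp.single 0 (c.1 : ℕ) + Finsupp.single 1 (c.2.1 : ℕ)) ((smallw u).coeff c.2.2) = u c := by
  rw [smallw, finsetSum_coeff, MvPolynomial.coeff_sum, Finset.sum_eq_single c]
  · rw [coeff_C_mul_X_pow, if_pos rfl, coeff_C_mul_mono2, if_pos ⟨rfl, rfl⟩]
  · rintro c' - hc
    rw [coeff_C_mul_X_pow]
    split_ifs with h
    · rw [coeff_C_mul_mono2, if_neg]
      rintro ⟨h1, h2⟩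
      exact hc (Prod.ext (Fin.ext h1) (Prod.ext (Fin.ext h2) (Fin.ext h.symm)))
    · simp
  · simp

lemma smallw_mem {l D : ℕ} (u : Idx l D → Ω) : smallw u ∈ (filt Ω).poly.W (l + D) := by
  refine sum_mem fun c _ => ?_
  have h1 := (filt Ω).C_mem ((filt Ω).mul (Cmem (u c) 0) (mono2_mem (Ω := Ω) c.1.2.le c.2.1.2.le))
  rw [zero_add] at h1
  exact (filt Ω).poly.mono (by have := c.2.2.2; omega) ((filt Ω).poly.mul h1 ((filt Ω).X_pow_mem (c.2.2 : ℕ)))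

lemma smallw_degree {l D : ℕ} (u : Idx l D → Ω) : (smallw u).degree < D := by
  rw [← mem_degreeLT]
  refine sum_mem fun c _ => ?_
  rw [mem_degreeLT]
  refine (degree_C_mul_X_pow_le _ _).trans_lt ?_
  exact_mod_cast c.2.2.2

lemma exists_repr [CharP Ω 2] (j : ℕ) {m l D : ℕ} (κ : Idx m D → Idx l D → Ω) (x : Fin 2 → Ω) (y : Ω) :
    ∃ r0 r1 r2 : (MvPolynomial (Fin 2) Ω)[X],
    (smallw fun c => ∑ a, κ a c * (x 0 ^ (2 ^ j * a.1 : ℕ) * x 1 ^ (2 ^ j * a.2.1 : ℕ) * y ^ (2 ^ j * a.2.2 : ℕ))) -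
     (C ((MvPolynomial.X 0 - MvPolynomial.C (x 0)) ^ 2 ^ j) * r0 +
      C ((MvPolynomial.X 1 - MvPolynomial.C (x 1)) ^ 2 ^ j) * r1 +
      (X - C (MvPolynomial.C y)) ^ 2 ^ j * r2) = bigB (2 ^ j) κ := by
  set J : Ideal (MvPolynomial (Fin 2) Ω)[X] := Ideal.span {C ((MvPolynomial.X 0 - MvPolynomial.C (x 0)) ^ 2 ^ j),
    C ((MvPolynomial.X 1 - MvPolynomial.C (x 1)) ^ 2 ^ j), (X - C (MvPolynomial.C y)) ^ 2 ^ j} with hJ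
  set ψ := Ideal.Quotient.mk J with hψ
  have e0 : (ψ (C (MvPolynomial.X 0))) ^ 2 ^ j = (ψ (C (MvPolynomial.C (x 0)))) ^ 2 ^ j := by
    rw [← sub_eq_zero, ← map_pow ψ, ← map_pow ψ, ← map_sub ψ, Ideal.Quotient.eq_zero_iff_mem, ← sub_pow_char_pow,
      ← C_sub, ← C_pow]
    exact Ideal.subset_span (by simp)
  have e1 : (ψ (C (MvPolynomial.X 1))) ^ 2 ^ j = (ψ (C (MvPolynomial.C (x 1)))) ^ 2 ^ j := by
    rw [← sub_eq_zero, ← map_pow ψ, ← map_pow ψ, ← map_sub ψ, Ideal.Quotient.eq_zero_iff_mem, ← sub_pow_char_pow,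
      ← C_sub, ← C_pow]
    exact Ideal.subset_span (by simp)
  have e2 : (ψ X) ^ 2 ^ j = (ψ (C (MvPolynomial.C y))) ^ 2 ^ j := by
    rw [← sub_eq_zero, ← map_pow ψ, ← map_pow ψ, ← map_sub ψ, Ideal.Quotient.eq_zero_iff_mem, ← sub_pow_char_pow]
    exact Ideal.subset_span (by simp)
  have key : ψ (smallw fun c => ∑ a, κ a c * (x 0 ^ (2 ^ j * a.1 : ℕ) * x 1 ^ (2 ^ j * a.2.1 : ℕ) * y ^ (2 ^ j * a.2.2 : ℕ)))
      = ψ (bigB (2 ^ j) κ) := by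
    rw [smallw, bigB, Finset.sum_comm, map_sum, map_sum]
    refine Finset.sum_congr rfl fun c _ => ?_
    rw [map_sum, map_sum, Finset.sum_mul, map_sum, Finset.sum_mul, map_sum]
    refine Finset.sum_congr rfl fun a _ => ?_
    simp only [mono2_eq, map_mul, map_pow, pow_add, pow_mul, e0, e1, e2]
    ring
  rw [← sub_eq_zero, ← map_sub, Ideal.Quotient.eq_zero_iff_mem, hJ, Ideal.span, Submodule.mem_span_triple] at key
  obtain ⟨r0, r1, r2, h⟩ := key
  refine ⟨r0, r1, r2, ?_⟩
  rw [sub_eq_iff_eq_add, ← sub_eq_iff_eq_add', ← h]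
  simp only [smul_eq_mul]; ring

/-- The roots of a separable specialisation. -/
lemma exists_roots [IsAlgClosed Ω] {F u v : (MvPolynomial (Fin 2) Ω)[X]} (hF : F.Monic)
    {δ : MvPolynomial (Fin 2) Ω} (huv : u * F + v * derivative F = C δ) (x : Fin 2 → Ω)
    (hx : MvPolynomial.eval x δ ≠ 0) :
    ∃ s : Finset Ω, s.card = F.natDegree ∧ ∀ y ∈ s, eval₂ (MvPolynomial.eval x) y F = 0 := by
  classical
  set G := F.map (MvPolynomial.eval x) with hG
  have hGm : G.Monic := hF.map _
  have hsep : G.Separable := by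
    have h1 := congrArg (Polynomial.map (MvPolynomial.eval x)) huv
    simp only [Polynomial.map_add, Polynomial.map_mul, ← derivative_map, map_C] at h1
    refine ⟨C (MvPolynomial.eval x δ)⁻¹ * u.map (MvPolynomial.eval x), C (MvPolynomial.eval x δ)⁻¹ * v.map (MvPolynomial.eval x), ?_⟩
    rw [mul_assoc, mul_assoc, ← mul_add, hG, h1, ← C_mul, inv_mul_cancel₀ hx, C_1]
  refine ⟨G.roots.toFinset, ?_, ?_⟩
  · rw [Multiset.toFinset_card_of_nodup (nodup_roots hsep), ← (IsAlgClosed.splits G).natDegree_eq_card_roots,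
      hG, hF.natDegree_map]
  · intro y hy
    rw [Multiset.mem_toFinset, mem_roots hGm.ne_zero] at hy
    rw [← eval_map]; exact hy

/-- Nonvanishing of the auxiliary polynomial. -/
lemma nonvanish [CharP Ω 2] [IsAlgClosed Ω] {F u v : (MvPolynomial (Fin 2) Ω)[X]} (hF : F.Monic)
    (hirr : Irreducible F) {D : ℕ} (hFD : F.natDegree = D) (hD : 0 < D)
    (hW : F ∈ (filt Ω).poly.W D) {δ : MvPolynomial (Fin 2) Ω} (hδ : δ ≠ 0)
    (huv : u * F + v * derivative F = C δ) {j m l : ℕ} (hQ : D * (l + 2 * D) < 2 ^ j)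
    (κ : Idx m D → Idx l D → Ω) (hdvd : F ∣ bigB (2 ^ j) κ) : κ = 0 := by
  classical
  have step1 : ∀ (x : Fin 2 → Ω) (y : Ω), eval₂ (MvPolynomial.eval x) y F = 0 → ∀ c,
      ∑ a, κ a c * (x 0 ^ (2 ^ j * a.1 : ℕ) * x 1 ^ (2 ^ j * a.2.1 : ℕ) * y ^ (2 ^ j * a.2.2 : ℕ)) = 0 := by
    intro x y hy c
    obtain ⟨r0, r1, r2, h⟩ := exists_repr j κ x y
    have h0 := local_vanish hF hirr (hFD ▸ hD) (hFD ▸ hW) (smallw_mem _)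
      (by rw [degree_eq_natDegree hF.ne_zero, hFD]; exact smallw_degree _)
      (by rw [hFD]; convert hQ using 2; ring) x y hy r0 r1 r2 (h ▸ hdvd)
    have := smallw_coeff (fun c => ∑ a, κ a c * (x 0 ^ (2 ^ j * a.1 : ℕ) * x 1 ^ (2 ^ j * a.2.1 : ℕ) * y ^ (2 ^ j * a.2.2 : ℕ))) c
    rw [h0] at this
    simpa using this.symm
  have step2 : ∀ (a3 : Fin D) c, (∑ a1 : Fin m, ∑ a2 : Fin m,
      MvPolynomial.C (κ (a1, a2, a3) c) * mono2 Ω (2 ^ j * a1) (2 ^ j * a2)) = 0 := by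
    intro a3 c
    have : (∑ a1 : Fin m, ∑ a2 : Fin m,
      MvPolynomial.C (κ (a1, a2, a3) c) * mono2 Ω (2 ^ j * a1) (2 ^ j * a2)) * δ = 0 := by
      apply MvPolynomial.funext
      intro x
      rw [map_mul, map_zero]
      by_cases hx : MvPolynomial.eval x δ = 0
      · rw [hx, mul_zero]
      obtain ⟨s, hs, hs0⟩ := exists_roots hF huv x hx
      set S : Fin D → Ω := fun a3 => ∑ a1 : Fin m, ∑ a2 : Fin m, κ (a1, a2, a3) c * (x 0 ^ (2 ^ j * a1 : ℕ) * x 1 ^ (2 ^ j * a2 : ℕ)) with hS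
      set p : Polynomial Ω := ∑ a3 : Fin D, C (S a3) * X ^ (a3 : ℕ) with hp
      have hpdeg : p.degree < D := by
        rw [← mem_degreeLT]
        refine sum_mem fun c _ => ?_
        rw [mem_degreeLT]
        refine (degree_C_mul_X_pow_le _ _).trans_lt ?_
        exact_mod_cast c.2
      have hp0 : p = 0 := by
        by_contra hne
        refine hne (eq_zero_of_natDegree_lt_card_of_eval_eq_zero' p (s.image (iterateFrobenius Ω 2 j)) ?_ ?_)
        · intro z hz
          obtain ⟨y, hy, rfl⟩ := Finset.mem_image.1 hz
          have := step1 x y (hs0 y hy) c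
          rw [iterateFrobenius_def, hp, eval_finsetSum, ← this, Fintype.sum_prod_type]
          simp_rw [Fintype.sum_prod_type]
          simp only [eval_mul, eval_C, eval_pow, eval_X, hS, Finset.sum_mul]
          rw [Finset.sum_comm]
          refine Finset.sum_congr rfl fun a1 _ => ?_
          rw [Finset.sum_comm]
          refine Finset.sum_congr rfl fun a2 _ => Finset.sum_congr rfl fun a3 _ => ?_
          ring
        · rw [Finset.card_image_of_injective _ (iterateFrobenius_inj Ω 2 j), hs, hFD]
          rwa [natDegree_lt_iff_degree_lt hne]
      have hSa : S a3 = 0 := by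
        have := congrArg (fun q => q.coeff (a3 : ℕ)) hp0
        simp only [hp, finsetSum_coeff, coeff_C_mul_X_pow, coeff_zero] at this
        rw [Finset.sum_eq_single a3] at this
        · simpa using this
        · intro b _ hb; rw [if_neg]; exact fun h => hb (Fin.ext h.symm)
        · simp
      have : MvPolynomial.eval x (∑ a1 : Fin m, ∑ a2 : Fin m,
        MvPolynomial.C (κ (a1, a2, a3) c) * mono2 Ω (2 ^ j * a1) (2 ^ j * a2)) = S a3 := by
        simp [hS, mono2_eq]
      rw [this, hSa, zero_mul]
    exact (mul_eq_zero.1 this).resolve_right hδ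
  funext ⟨a1, a2, a3⟩ c
  have := congrArg (MvPolynomial.coeff (Finsupp.single 0 (2 ^ j * a1 : ℕ) + Finsupp.single 1 (2 ^ j * a2 : ℕ))) (step2 a3 c)
  simp only [MvPolynomial.coeff_sum, coeff_C_mul_mono2, MvPolynomial.coeff_zero] at this
  rw [Finset.sum_eq_single a1, Finset.sum_eq_single a2] at this
  · simpa using this
  · intro b _ hb; rw [if_neg]; rintro ⟨-, h⟩; exact hb (Fin.ext (Nat.eq_of_mul_eq_mul_left (by positivity) h))
  · simp
  · intro b _ hb; refine Finset.sum_eq_zero fun b2 _ => ?_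
    rw [if_neg]; rintro ⟨h, -⟩; exact hb (Fin.ext (Nat.eq_of_mul_eq_mul_left (by positivity) h))
  · simp
end
end KW

namespace KW
open Polynomial

section
variable {K : Type*} [Field K]

/-- The difference quotient `(F(Z) - F(Y)) / (Z - Y)`. -/
noncomputable def dq (F : (MvPolynomial (Fin 2) K)[X]) : (MvPolynomial (Fin 2) K)[X][X] :=
  (F.map C - C F) /ₘ (X - C X)

lemma dq_mul (F : (MvPolynomial (Fin 2) K)[X]) : (X - C X) * dq F = F.map C - C F := by
  rw [dq, mul_divByMonic_eq_iff_isRoot, IsRoot.def, eval_sub, eval_C, eval_map, sub_eq_zero]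
  exact eval₂_C_X

lemma natDegree_aux {F : (MvPolynomial (Fin 2) K)[X]} (hF : F.Monic) (hD : 0 < F.natDegree) :
    (F.map C - C F : (MvPolynomial (Fin 2) K)[X][X]).natDegree = F.natDegree ∧
    (F.map C - C F : (MvPolynomial (Fin 2) K)[X][X]).Monic := by
  have h1 : (F.map C : (MvPolynomial (Fin 2) K)[X][X]).Monic := hF.map _
  have h2 : (C F : (MvPolynomial (Fin 2) K)[X][X]).degree < (F.map C : (MvPolynomial (Fin 2) K)[X][X]).degree := by
    refine degree_C_le.trans_lt ?_
    rw [degree_eq_natDegree h1.ne_zero, hF.natDegree_map]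
    exact_mod_cast hD
  constructor
  · rw [natDegree_sub_C, hF.natDegree_map]
  · exact h1.sub_of_left h2

lemma dq_natDegree {F : (MvPolynomial (Fin 2) K)[X]} (hF : F.Monic) (hD : 0 < F.natDegree) :
    (dq F).natDegree = F.natDegree - 1 := by
  rw [dq, natDegree_divByMonic _ (monic_X_sub_C _), (natDegree_aux hF hD).1, natDegree_X_sub_C]

lemma dq_monic {F : (MvPolynomial (Fin 2) K)[X]} (hF : F.Monic) (hD : 0 < F.natDegree) :
    (dq F).Monic := by
  obtain ⟨h1, h2⟩ := natDegree_aux hF hD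
  rw [Monic, dq, leadingCoeff_divByMonic_of_monic (monic_X_sub_C _), h2.leadingCoeff]
  rw [degree_X_sub_C, degree_eq_natDegree h2.ne_zero, h1]
  exact_mod_cast hD

lemma dq_mem {F : (MvPolynomial (Fin 2) K)[X]} {D : ℕ} (hF : F.Monic) (hFD : F.natDegree = D + 1)
    (hW : F ∈ (filt K).poly.W (D + 1)) : dq F ∈ (filt K).poly.poly.W D := by
  refine Filt.divByMonic_mem _ ?_ ?_ (filt K).X_mem
  · refine sub_mem ?_ ((filt K).poly.C_mem hW)
    refine ⟨fun i hi => ?_, fun i hi => ?_⟩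
    · rw [coeff_map]; exact (filt K).C_mem (hW.1 i hi)
    · rw [coeff_map, hW.2 i hi, C_0]
  · rw [(natDegree_aux hF (by omega)).1, hFD]

/-- The auxiliary polynomial in `Y` and `Z`. -/
noncomputable def Th (M : ℕ) {m l D : ℕ} (κ : Idx m D → Idx l D → K) :
    (MvPolynomial (Fin 2) K)[X][X] :=
  ∑ a, ∑ c, C (C (MvPolynomial.C (κ a c) * mono2 K (a.1 + M * c.1) (a.2.1 + M * c.2.1)) *
    X ^ (M * c.2.2 : ℕ)) * X ^ (a.2.2 : ℕ)

lemma Th_add (M : ℕ) {m l D : ℕ} (κ κ' : Idx m D → Idx l D → K) :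
    Th M (κ + κ') = Th M κ + Th M κ' := by
  rw [Th, Th, Th, ← Finset.sum_add_distrib]
  refine Finset.sum_congr rfl fun a _ => ?_
  rw [← Finset.sum_add_distrib]
  refine Finset.sum_congr rfl fun c _ => ?_
  rw [← add_mul, ← C_add, ← add_mul, ← C_add, ← add_mul, ← MvPolynomial.C_add, Pi.add_apply,
    Pi.add_apply]

lemma Th_mem {M m l D : ℕ} (κ : Idx m D → Idx l D → K) :
    Th M κ ∈ (filt K).poly.poly.W ((m - 1) + M * (l - 1) + M * (D - 1) + (D - 1)) := by
  refine sum_mem fun a _ => sum_mem fun c _ => ?_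
  have e : ∀ {n} (i : Fin n), (i : ℕ) ≤ n - 1 := fun i => by have := i.2; omega
  have h1 := (filt K).C_mem ((filt K).mul (Cmem (κ a c) 0) (mono2_mem (Ω := K)
    (add_le_add (e a.1) (Nat.mul_le_mul_left M (e c.1)))
    (add_le_add (e a.2.1) (Nat.mul_le_mul_left M (e c.2.1)))))
  rw [zero_add] at h1
  have h2 := (filt K).poly.mul h1 ((filt K).poly.mono (Nat.mul_le_mul_left M (e c.2.2)) ((filt K).X_pow_mem (M * c.2.2 : ℕ)))
  exact (filt K).poly.poly.mul ((filt K).poly.C_mem h2) ((filt K).poly.poly.mono (e a.2.2) ((filt K).poly.X_pow_mem (a.2.2 : ℕ)))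

/-- Remainder coefficients. -/
noncomputable def Psi (F : (MvPolynomial (Fin 2) K)[X]) (p : (MvPolynomial (Fin 2) K)[X][X]) (k i : ℕ) :
    MvPolynomial (Fin 2) K := ((p %ₘ dq F).coeff k %ₘ F).coeff i

lemma Psi_add (F : (MvPolynomial (Fin 2) K)[X]) (p p' : (MvPolynomial (Fin 2) K)[X][X]) (k i : ℕ) :
    Psi F (p + p') k i = Psi F p k i + Psi F p' k i := by
  rw [Psi, add_modByMonic, coeff_add, add_modByMonic, coeff_add]; rfl

lemma Psi_mem {F : (MvPolynomial (Fin 2) K)[X]} {D : ℕ} (hF : F.Monic) (hFD : F.natDegree = D + 1)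
    (hW : F ∈ (filt K).poly.W (D + 1)) {N : ℕ} {p : (MvPolynomial (Fin 2) K)[X][X]}
    (hp : p ∈ (filt K).poly.poly.W N) (k i : ℕ) : Psi F p k i ∈ (filt K).W N := by
  have h1 : dq F ∈ (filt K).poly.poly.W (dq F).natDegree := by
    rw [dq_natDegree hF (by omega), hFD]; exact dq_mem hF hFD hW
  have h2 := (filt K).poly.coeff_mem ((filt K).poly.modByMonic_mem (dq_monic hF (by omega)) h1 hp) k
  have h3 := (filt K).coeff_mem ((filt K).modByMonic_mem hF (by rw [hFD]; exact hW) h2) i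
  exact (filt K).mono (by omega) h3

/-- Pigeonhole. -/
lemma exists_kappa [Fintype K] [CharP K 2] {F : (MvPolynomial (Fin 2) K)[X]} {D : ℕ} (hF : F.Monic)
    (hFD : F.natDegree = D + 1) (hW : F ∈ (filt K).poly.W (D + 1)) (μ m l N : ℕ)
    (hN : (m - 1) + 2 ^ μ * (l - 1) + 2 ^ μ * D + D ≤ N)
    (hcard : D * (D + 1) * ((N + 1) * (N + 1)) < (m * (m * (D + 1))) * (l * (l * (D + 1)))) :
    ∃ κ : Idx m (D + 1) → Idx l (D + 1) → K, κ ≠ 0 ∧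
      ∀ k i, k < D → i < D + 1 → Psi F (Th (2 ^ μ) fun a c => κ a c ^ 2 ^ μ) k i = 0 := by
  classical
  let Φ : (Idx m (D + 1) → Idx l (D + 1) → K) → (Fin D × Fin (D + 1) → Fin (N + 1) × Fin (N + 1) → K) :=
    fun κ ki n => MvPolynomial.coeff (Finsupp.single 0 (n.1 : ℕ) + Finsupp.single 1 (n.2 : ℕ))
      (Psi F (Th (2 ^ μ) fun a c => κ a c ^ 2 ^ μ) ki.1 ki.2)
  have hlt : Fintype.card (Fin D × Fin (D + 1) → Fin (N + 1) × Fin (N + 1) → K) <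
      Fintype.card (Idx m (D + 1) → Idx l (D + 1) → K) := by
    simp only [Fintype.card_fun, Fintype.card_prod, Fintype.card_fin, ← pow_mul]
    apply Nat.pow_lt_pow_right Fintype.one_lt_card
    calc _ = _ := by ring
      _ < _ := hcard
      _ = _ := by ring
  obtain ⟨κ1, κ2, hne, heq⟩ := Fintype.exists_ne_map_eq_of_card_lt Φ hlt
  refine ⟨κ1 - κ2, sub_ne_zero.2 hne, fun k i hk hi => ?_⟩
  have e : (fun a c => (κ1 - κ2) a c ^ 2 ^ μ) = (fun a c => κ1 a c ^ 2 ^ μ) - fun a c => κ2 a c ^ 2 ^ μ := by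
    funext a c; simp [sub_pow_char_pow]
  rw [e]
  have e2 : Psi F (Th (2 ^ μ) ((fun a c => κ1 a c ^ 2 ^ μ) - fun a c => κ2 a c ^ 2 ^ μ)) k i =
      Psi F (Th (2 ^ μ) fun a c => κ1 a c ^ 2 ^ μ) k i - Psi F (Th (2 ^ μ) fun a c => κ2 a c ^ 2 ^ μ) k i := by
    rw [eq_sub_iff_add_eq, ← Psi_add, ← Th_add, sub_add_cancel]
  rw [e2]
  have hmem : ∀ κ : Idx m (D + 1) → Idx l (D + 1) → K, Psi F (Th (2 ^ μ) κ) k i ∈ (filt K).W N := fun κ =>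
    Psi_mem hF hFD hW ((filt K).poly.poly.mono (by simpa using hN) (Th_mem κ)) k i
  have hm := sub_mem (hmem fun a c => κ1 a c ^ 2 ^ μ) (hmem fun a c => κ2 a c ^ 2 ^ μ)
  set P := Psi F (Th (2 ^ μ) fun a c => κ1 a c ^ 2 ^ μ) k i - Psi F (Th (2 ^ μ) fun a c => κ2 a c ^ 2 ^ μ) k i with hP
  by_contra h0
  obtain ⟨s, hs⟩ := MvPolynomial.support_nonempty.2 h0
  have hs0 := (MvPolynomial.degreeOf_le_iff.1 (hm 0)) s hs
  have hs1 := (MvPolynomial.degreeOf_le_iff.1 (hm 1)) s hs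
  apply MvPolynomial.mem_support_iff.1 hs
  have h2 := congrFun (congrFun heq (⟨k, hk⟩, ⟨i, hi⟩)) (⟨s 0, by omega⟩, ⟨s 1, by omega⟩)
  simp only [Φ] at h2
  have h3 : Finsupp.single 0 (s 0) + Finsupp.single 1 (s 1) = s := by
    ext j; fin_cases j <;> simp
  rw [h3] at h2
  rw [hP, MvPolynomial.coeff_sub, h2, sub_self]

/-- Vanishing at pairs of distinct roots. -/
lemma pair_vanish {Ω : Type*} [Field Ω] {F : (MvPolynomial (Fin 2) K)[X]} {D : ℕ} (hF : F.Monic)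
    (hFD : F.natDegree = D + 1) (p : (MvPolynomial (Fin 2) K)[X][X])
    (hp : ∀ k i, k < D → i < D + 1 → Psi F p k i = 0)
    (σ : MvPolynomial (Fin 2) K →+* Ω) (y z : Ω) (hyz : z ≠ y) (hy : eval₂ σ y F = 0)
    (hz : eval₂ σ z F = 0) : eval₂ (eval₂RingHom σ y) z p = 0 := by
  have hg : eval₂ (eval₂RingHom σ y) z (dq F) = 0 := by
    have h1 := congrArg (eval₂ (eval₂RingHom σ y) z) (dq_mul F)
    rw [eval₂_mul, eval₂_sub, eval₂_sub, eval₂_X, eval₂_C, eval₂_C, eval₂_map, coe_eval₂RingHom, eval₂_X, hy] at h1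
    have h2 : (eval₂RingHom σ y).comp C = σ := by ext <;> simp
    rw [h2, hz, sub_zero] at h1
    exact (mul_eq_zero.1 h1).resolve_left (sub_ne_zero.2 hyz)
  have h1 : p %ₘ dq F + dq F * (p /ₘ dq F) = p := modByMonic_add_div p (dq F)
  rw [← h1, eval₂_add, eval₂_mul, hg, zero_mul, add_zero, eval₂_eq_sum_range]
  refine Finset.sum_eq_zero fun k _ => ?_
  suffices h : eval₂RingHom σ y ((p %ₘ dq F).coeff k) = 0 by rw [h, zero_mul]
  set c := (p %ₘ dq F).coeff k with hc
  by_cases hk : k < D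
  · have h2 : c %ₘ F + F * (c /ₘ F) = c := modByMonic_add_div c F
    rw [coe_eval₂RingHom, ← h2, eval₂_add, eval₂_mul, hy, zero_mul, add_zero]
    have : c %ₘ F = 0 := by
      ext1 i
      by_cases hi : i < D + 1
      · exact hp k i hk hi
      · rw [coeff_zero]
        apply coeff_eq_zero_of_degree_lt
        refine (degree_modByMonic_lt c hF).trans_le ?_
        rw [degree_eq_natDegree hF.ne_zero, hFD]
        exact_mod_cast not_lt.1 hi
    rw [this, eval₂_zero]
  · have : c = 0 := by
      apply coeff_eq_zero_of_degree_lt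
      have hm := dq_monic hF (by omega)
      refine (degree_modByMonic_lt p hm).trans_le ?_
      rw [degree_eq_natDegree hm.ne_zero, dq_natDegree hF (by omega), hFD]
      exact_mod_cast not_lt.1 hk
    rw [this, map_zero]
end
end KW

namespace KW
open Polynomial

section
variable {K : Type*} [Field K]

lemma bigB_mem {Q m l D : ℕ} (κ : Idx m D → Idx l D → K) :
    bigB Q κ ∈ (filt K).poly.W (Q * (m - 1) + (l - 1) + (Q * (D - 1) + (D - 1))) := by
  refine sum_mem fun a _ => sum_mem fun c _ => ?_
  have e : ∀ {n} (i : Fin n), (i : ℕ) ≤ n - 1 := fun i => by have := i.2; omega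
  have h1 := (filt K).C_mem ((filt K).mul (Cmem (κ a c) 0) (mono2_mem (Ω := K)
    (add_le_add (Nat.mul_le_mul_left Q (e a.1)) (e c.1))
    (add_le_add (Nat.mul_le_mul_left Q (e a.2.1)) (e c.2.1))))
  rw [zero_add] at h1
  exact (filt K).poly.mul h1 ((filt K).poly.mono
    (add_le_add (Nat.mul_le_mul_left Q (e a.2.2)) (e c.2.2)) ((filt K).X_pow_mem (Q * a.2.2 + c.2.2 : ℕ)))

lemma bigB_pow [CharP K 2] {Ω : Type*} [Field Ω] [CharP Ω 2] (τ : K →+* Ω) (μ j : ℕ)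
    (hfrob : ∀ x : K, x ^ 2 ^ (μ + j) = x)
    {m l D : ℕ} (κ : Idx m D → Idx l D → K) (x : Fin 2 → K) (y : Ω) :
    (eval₂ (τ.comp (MvPolynomial.eval x)) y (bigB (2 ^ j) κ)) ^ 2 ^ μ =
    eval₂ (eval₂RingHom (τ.comp (MvPolynomial.eval x)) y) (y ^ 2 ^ (μ + j))
      (Th (2 ^ μ) fun a c => κ a c ^ 2 ^ μ) := by
  have h0 : τ (x 0) ^ 2 ^ (μ + j) = τ (x 0) := by rw [← map_pow, hfrob]
  have h1 : τ (x 1) ^ 2 ^ (μ + j) = τ (x 1) := by rw [← map_pow, hfrob]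
  rw [bigB, Th, eval₂_finsetSum, eval₂_finsetSum, sum_pow_char_pow]
  refine Finset.sum_congr rfl fun a _ => ?_
  rw [eval₂_finsetSum, eval₂_finsetSum, sum_pow_char_pow]
  refine Finset.sum_congr rfl fun c _ => ?_
  simp only [eval₂_mul, eval₂_C, eval₂_pow, eval₂_X, coe_eval₂RingHom, RingHom.comp_apply, map_mul,
    mono2_eq, map_pow, MvPolynomial.eval_C, MvPolynomial.eval_X]
  have e0 : (τ (x 0) ^ (2 ^ j * (a.1 : ℕ) + c.1)) ^ 2 ^ μ = τ (x 0) ^ ((a.1 : ℕ) + 2 ^ μ * c.1) := by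
    conv_rhs => rw [pow_add, ← h0, ← pow_mul, h0, ← pow_add]
    rw [← pow_mul]; congr 1; ring
  have e1 : (τ (x 1) ^ (2 ^ j * (a.2.1 : ℕ) + c.2.1)) ^ 2 ^ μ = τ (x 1) ^ ((a.2.1 : ℕ) + 2 ^ μ * c.2.1) := by
    conv_rhs => rw [pow_add, ← h1, ← pow_mul, h1, ← pow_add]
    rw [← pow_mul]; congr 1; ring
  rw [mul_pow, mul_pow, mul_pow, e0, e1, ← pow_mul, ← pow_mul]
  have e2 : y ^ ((2 ^ j * (a.2.2 : ℕ) + c.2.2) * 2 ^ μ) = y ^ (2 ^ μ * (c.2.2 : ℕ)) * y ^ (2 ^ (μ + j) * (a.2.2 : ℕ)) := by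
    rw [← pow_add]; congr 1; ring
  rw [e2]; ring

lemma map_bigB {Ω : Type*} [Field Ω] (τ : K →+* Ω) (Q : ℕ) {m l D : ℕ} (κ : Idx m D → Idx l D → K) :
    (bigB Q κ).map (MvPolynomial.map τ) = bigB Q fun a c => τ (κ a c) := by
  simp only [bigB, Polynomial.map_sum, Polynomial.map_mul, Polynomial.map_pow, map_C, map_X, map_mul,
    mono2_eq, map_pow, MvPolynomial.map_C, MvPolynomial.map_X]

lemma count_ineq (D M : ℕ) (hM : 16 * (D + 2) ^ 2 ≤ M) :
    (D + 1) * (D + 2) * ((M * (M + D + 1)) * (M * (M + D + 1))) <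
      ((M - 2 * (D + 2)) * ((M - 2 * (D + 2)) * (D + 2))) * (M * (M * (D + 2))) := by
  obtain ⟨m, rfl⟩ : ∃ m, M = m + 2 * (D + 2) := ⟨M - 2 * (D + 2), by
    have : 2 * (D + 2) ≤ M := by nlinarith
    omega⟩
  rw [Nat.add_sub_cancel]
  set M := m + 2 * (D + 2) with hMd
  have hm : 14 * (D + 2) ^ 2 ≤ m := by nlinarith
  have key : (D + 1) * ((M + D + 1) * (M + D + 1)) < (D + 2) * (m * m) := by
    rw [hMd]
    nlinarith [Nat.mul_le_mul_left m hm, Nat.mul_le_mul_left (D ^ 2) hm]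
  have hMpos : 0 < M := by omega
  calc (D + 1) * (D + 2) * ((M * (M + D + 1)) * (M * (M + D + 1)))
      = ((D + 1) * ((M + D + 1) * (M + D + 1))) * (M * M * (D + 2)) := by ring
    _ < ((D + 2) * (m * m)) * (M * M * (D + 2)) := by
        apply Nat.mul_lt_mul_of_pos_right key; positivity
    _ = _ := by ring

/-- Weak Lang-Weil theorem for surfaces (Stepanov-Bombieri method). -/
theorem stepanov [Fintype K] [CharP K 2] {Ω : Type*} [Field Ω] [CharP Ω 2] [IsAlgClosed Ω]
    (τ : K →+* Ω) {F u v : (MvPolynomial (Fin 2) K)[X]} {δ : MvPolynomial (Fin 2) K} {D E μ j : ℕ}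
    (hF : F.Monic) (hFD : F.natDegree = D + 2) (hW : F ∈ (filt K).poly.W (D + 2))
    (hirr : Irreducible (F.map (MvPolynomial.map τ))) (hδ0 : δ ≠ 0) (hδ : δ ∈ (filt K).W E)
    (huv : u * F + v * derivative F = C δ)
    (hμ : 16 * (D + 2) ^ 2 ≤ 2 ^ μ) (hj1 : (D + 2) * (2 ^ μ + 2 * (D + 2)) < 2 ^ j)
    (hj2 : 2 ^ μ + D + 2 + E < 2 ^ j) (hq : Fintype.card K = 2 ^ (μ + j))
    (hno : ∀ x : Fin 2 → K, MvPolynomial.eval x δ ≠ 0 → ∀ y : K, eval₂ (MvPolynomial.eval x) y F ≠ 0) :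
    False := by
  classical
  have hfrob : ∀ x : K, x ^ 2 ^ (μ + j) = x := fun x => by rw [← hq]; exact FiniteField.pow_card x
  set M := 2 ^ μ with hM
  set Q := 2 ^ j with hQ
  have hMge : 2 * (D + 2) < M := by nlinarith
  set m := M - 2 * (D + 2) with hm
  have h1M : 1 ≤ M := by omega
  have hcount : (D + 1) * (D + 1 + 1) * ((M * (M + D + 1) - 1 + 1) * (M * (M + D + 1) - 1 + 1)) <
      (m * (m * (D + 1 + 1))) * (M * (M * (D + 1 + 1))) := by
    rw [Nat.sub_add_cancel (by nlinarith)]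
    exact count_ineq D M hμ
  have hnum : (m - 1) + M * (M - 1) + M * (D + 1) + (D + 1) ≤ M * (M + D + 1) - 1 := by
    obtain ⟨M', hM'⟩ : ∃ M', M = M' + 1 := ⟨M - 1, by omega⟩
    have : M * (M - 1) + M * (D + 1) + M = M * (M + D + 1) := by
      rw [hM', Nat.add_sub_cancel]; ring
    omega
  obtain ⟨κ, hκ0, hκ⟩ := exists_kappa hF hFD hW μ m M (M * (M + D + 1) - 1) hnum hcount
  have hfrobΩ : ∀ (x : Fin 2 → K) (y : Ω), eval₂ (τ.comp (MvPolynomial.eval x)) (y ^ 2 ^ (μ + j)) F =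
      (eval₂ (τ.comp (MvPolynomial.eval x)) y F) ^ 2 ^ (μ + j) := by
    intro x y
    rw [eval₂_eq_sum_range, eval₂_eq_sum_range, sum_pow_char_pow]
    refine Finset.sum_congr rfl fun i _ => ?_
    rw [mul_pow, RingHom.comp_apply, ← map_pow, hfrob, ← pow_mul, ← pow_mul, mul_comm i]
  have hfix : ∀ y : Ω, y ^ 2 ^ (μ + j) = y → ∃ z : K, τ z = y := by
    intro y hy
    by_contra! hz
    have hq1 : 1 < 2 ^ (μ + j) := by rw [← hq]; exact Fintype.one_lt_card
    refine FiniteField.X_pow_card_sub_X_ne_zero Ω (p := 2 ^ (μ + j)) hq1 ?_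
    refine eq_zero_of_natDegree_lt_card_of_eval_eq_zero' _ (insert y (Finset.univ.image τ)) ?_ ?_
    · intro z hz
      rw [eval_sub, eval_pow, eval_X]
      rcases Finset.mem_insert.1 hz with rfl | hz
      · rw [hy, sub_self]
      · obtain ⟨w, -, rfl⟩ := Finset.mem_image.1 hz
        rw [← map_pow, hfrob, sub_self]
    · rw [FiniteField.X_pow_card_sub_X_natDegree_eq Ω hq1, Finset.card_insert_of_notMem,
        Finset.card_image_of_injective _ τ.injective, Finset.card_univ, hq]
      · exact Nat.lt_succ_self _
      · intro h
        obtain ⟨w, -, hw⟩ := Finset.mem_image.1 h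
        exact hz w hw
  have hB0 : ∀ x : Fin 2 → K, MvPolynomial.eval x δ ≠ 0 → ∀ y : Ω,
      eval₂ (τ.comp (MvPolynomial.eval x)) y F = 0 →
      eval₂ (τ.comp (MvPolynomial.eval x)) y (bigB Q κ) = 0 := by
    intro x hx y hy
    have h1 := bigB_pow τ μ j hfrob κ x y
    rw [pair_vanish hF hFD _ hκ _ y _ ?_ hy ?_] at h1
    · exact eq_zero_of_pow_eq_zero h1
    · intro h
      obtain ⟨z, rfl⟩ := hfix y h
      rw [← hom_eval₂, map_eq_zero] at hy
      exact hno x hx z hy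
    · rw [hfrobΩ, hy, zero_pow (by positivity)]
  have hFm : (F.map (MvPolynomial.map τ)).Monic := hF.map _
  have huv' : u.map (MvPolynomial.map τ) * F.map (MvPolynomial.map τ) +
      v.map (MvPolynomial.map τ) * derivative (F.map (MvPolynomial.map τ)) = C (MvPolynomial.map τ δ) := by
    rw [derivative_map, ← Polynomial.map_mul, ← Polynomial.map_mul, ← Polynomial.map_add, huv, map_C]
  have hev : ∀ x : Fin 2 → K, (MvPolynomial.eval (τ ∘ x)).comp (MvPolynomial.map τ) =
      τ.comp (MvPolynomial.eval x) := by
    intro x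
    apply MvPolynomial.ringHom_ext <;> intro i <;> simp
  have hmod : bigB Q κ %ₘ F = 0 := by
    set R := bigB Q κ %ₘ F with hR
    have hRx : ∀ x : Fin 2 → K, MvPolynomial.eval x δ ≠ 0 → R.map (τ.comp (MvPolynomial.eval x)) = 0 := by
      intro x hx
      obtain ⟨s, hs, hs0⟩ := exists_roots hFm huv' (τ ∘ x) (by
        rw [← RingHom.comp_apply, hev, RingHom.comp_apply]; simpa using hx)
      by_contra hne
      refine hne (eq_zero_of_natDegree_lt_card_of_eval_eq_zero' _ s ?_ ?_)
      · intro y hy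
        have h1 := hs0 y hy
        rw [eval₂_map, hev] at h1
        have h2 : R + F * (bigB Q κ /ₘ F) = bigB Q κ := modByMonic_add_div _ _
        have h3 := hB0 x hx y h1
        rw [← h2, eval₂_add, eval₂_mul, h1, zero_mul, add_zero] at h3
        rw [eval_map, h3]
      · rw [hs, hF.natDegree_map]
        refine lt_of_le_of_lt natDegree_map_le ?_
        exact natDegree_modByMonic_lt _ hF (by rintro h; rw [h] at hFD; simp at hFD)
    ext1 i
    rw [coeff_zero]
    have hRi : R.coeff i * δ = 0 := by
      apply MvPolynomial.eq_zero_of_eval_zero_at_prod_finset _ (fun _ => (Finset.univ : Finset K))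
      · intro k
        have h1 := (filt K).coeff_mem ((filt K).modByMonic_mem hF (by rw [hFD]; exact hW) (bigB_mem (Q := Q) κ)) i
        have h2 := (filt K).mul h1 hδ k
        refine h2.trans_lt ?_
        rw [Finset.card_univ, hq, pow_add]
        refine lt_of_le_of_lt (Nat.add_le_add_right (Nat.sub_le _ _) _) ?_
        obtain ⟨m', hm'⟩ : ∃ m', M = m' + 1 + 2 * (D + 2) := ⟨M - 1 - 2 * (D + 2), by omega⟩
        have hmm : m = m' + 1 := by omega
        rw [← hM, ← hQ, hmm]
        have : M * Q = m' * Q + Q + 2 * (D + 2) * Q := by rw [hm']; ring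
        rw [this]
        have e1 : Q * (m' + 1 - 1) = m' * Q := by rw [Nat.add_sub_cancel]; ring
        have e2 : D + 2 - 1 = D + 1 := rfl
        rw [e1, e2]
        have e3 : 2 * (D + 2) * Q = Q * (D + 1) + Q * (D + 3) := by ring
        rw [e3]
        omega
      · intro x _
        rw [map_mul]
        by_cases hx : MvPolynomial.eval x δ = 0
        · rw [hx, mul_zero]
        · have h1 := congrArg (fun p => p.coeff i) (hRx x hx)
          simp only [coeff_map, coeff_zero, RingHom.comp_apply, map_eq_zero] at h1
          rw [h1, zero_mul]
    exact (mul_eq_zero.1 hRi).resolve_right hδ0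
  have hdvd : F.map (MvPolynomial.map τ) ∣ bigB (2 ^ j) fun a c => τ (κ a c) := by
    rw [← map_bigB]
    exact Polynomial.map_dvd _ ((modByMonic_eq_zero_iff_dvd hF).1 hmod)
  have hWm : F.map (MvPolynomial.map τ) ∈ (filt Ω).poly.W (D + 2) := by
    refine ⟨fun i hi => ?_, fun i hi => ?_⟩
    · intro k
      rw [coeff_map]
      have h1 := hW.1 i hi k
      rwa [MvPolynomial.degreeOf, MvPolynomial.degrees_map_of_injective _ τ.injective]
    · rw [coeff_map, hW.2 i hi, map_zero]
  have h0 := nonvanish hFm hirr (D := D + 2) (by rw [hF.natDegree_map, hFD]) (by omega) hWm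
    (δ := MvPolynomial.map τ δ) (by rwa [Ne, map_eq_zero_iff _ (MvPolynomial.map_injective _ τ.injective)])
    huv' hj1 _ hdvd
  apply hκ0
  funext a c
  have := congrFun (congrFun h0 a) c
  simpa using this
end
end KW

namespace KW

/-- The quotient polynomials `φ_j(x,y,z)` evaluated in a ring. -/
def ph {R : Type*} [CommRing R] (x y z : R) : ℕ → R
  | 0 => 0
  | 1 => 0
  | 2 => 0
  | 3 => 1
  | (j + 4) => (x * y + x * z + y * z + (x + y + z) ^ 2) * ph x y z (j + 2) +
      ((x + y) * (x + z) * (y + z)) * ph x y z (j + 1) + (x * y * z * (x + y + z)) * ph x y z j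

section
variable {R : Type*} [CommRing R]

lemma ph_four (x y z : R) (j : ℕ) : ph x y z (j + 4) =
    (x * y + x * z + y * z + (x + y + z) ^ 2) * ph x y z (j + 2) +
      ((x + y) * (x + z) * (y + z)) * ph x y z (j + 1) + (x * y * z * (x + y + z)) * ph x y z j := rfl

lemma ph_lt (x y z : R) {j : ℕ} (h : j < 3) : ph x y z j = 0 := by
  interval_cases j <;> rfl

lemma ph_mul [CharP R 2] (x y z : R) (j : ℕ) :
    ph x y z j * ((x + y) * (x + z) * (y + z)) = x ^ j + y ^ j + z ^ j + (x + y + z) ^ j := by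
  have h2 : (2 : R) = 0 := CharTwo.two_eq_zero
  have key : ∀ r w : R, w = x + y + z → (r = x ∨ r = y ∨ r = z ∨ r = w) →
      r ^ 4 = (x * y + x * z + y * z + (x + y + z) ^ 2) * r ^ 2 + ((x + y) * (x + z) * (y + z)) * r +
        (x * y * z * (x + y + z)) := by
    rintro r w rfl (rfl | rfl | rfl | rfl)
    · linear_combination (r * (r + y) * (r + z) * (r + (r + y + z)) - (r + y + z) * r ^ 3 - (r * y + r * z + y * z + (r + y + z) ^ 2) * r ^ 2 - ((r + y) * (r + z) * (y + z)) * r - r * y * z * r - r * y * z * (r + y + z)) * h2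
    · linear_combination (r * (r + x) * (r + z) * (r + (x + r + z)) - (x + r + z) * r ^ 3 - (x * r + x * z + r * z + (x + r + z) ^ 2) * r ^ 2 - ((x + r) * (x + z) * (r + z)) * r - x * r * z * r - x * r * z * (x + r + z)) * h2
    · linear_combination (r * (r + x) * (r + y) * (r + (x + y + r)) - (x + y + r) * r ^ 3 - (x * y + x * r + y * r + (x + y + r) ^ 2) * r ^ 2 - ((x + y) * (x + r) * (y + r)) * r - x * y * r * r - x * y * r * (x + y + r)) * h2
    · linear_combination ((x + y + z) * ((x + y + z) + x) * ((x + y + z) + y) * ((x + y + z) + z) - (x + y + z) * (x + y + z) ^ 3 - (x * y + x * z + y * z + (x + y + z) ^ 2) * (x + y + z) ^ 2 - ((x + y) * (x + z) * (y + z)) * (x + y + z) - x * y * z * (x + y + z) - x * y * z * (x + y + z)) * h2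
  have kx := key x _ rfl (by tauto)
  have ky := key y _ rfl (by tauto)
  have kz := key z _ rfl (by tauto)
  have kw := key (x + y + z) _ rfl (by tauto)
  induction j using Nat.strong_induction_on with
  | _ j ih =>
    match j with
    | 0 => simp only [ph]; linear_combination (-2) * h2
    | 1 => simp only [ph]; linear_combination (-(x + y + z)) * h2
    | 2 => simp only [ph]; linear_combination (-(x ^ 2 + y ^ 2 + z ^ 2 + x * y + x * z + y * z)) * h2
    | 3 => simp only [ph]; linear_combination (-(x ^ 3 + y ^ 3 + z ^ 3 + x^2*y+x^2*z+y^2*x+y^2*z+z^2*x+z^2*y + 2 * x * y * z)) * h2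
    | (j + 4) =>
      rw [ph_four]
      have i2 := ih (j + 2) (by omega)
      have i1 := ih (j + 1) (by omega)
      have i0 := ih j (by omega)
      linear_combination (x * y + x * z + y * z + (x + y + z) ^ 2) * i2 +
        ((x + y) * (x + z) * (y + z)) * i1 + (x * y * z * (x + y + z)) * i0 - x ^ j * kx - y ^ j * ky
          - z ^ j * kz - (x + y + z) ^ j * kw

lemma map_ph {S : Type*} [CommRing S] (σ : R →+* S) (x y z : R) (j : ℕ) :
    σ (ph x y z j) = ph (σ x) (σ y) (σ z) j := by
  induction j using Nat.strong_induction_on with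
  | _ j ih =>
    match j with
    | 0 => simp [ph]
    | 1 => simp [ph]
    | 2 => simp [ph]
    | 3 => simp [ph]
    | (j + 4) =>
      simp only [ph_four, map_add, map_mul, map_pow, ih (j + 2) (by omega), ih (j + 1) (by omega), ih j (by omega)]

lemma ph_homog (x y z T : R) (j : ℕ) : ph (x * T) (y * T) (z * T) (j + 3) = ph x y z (j + 3) * T ^ j := by
  induction j using Nat.strong_induction_on with
  | _ j ih =>
    match j with
    | 0 => simp [ph]
    | 1 => simp [ph]
    | 2 => simp [ph]; ring
    | (j + 3) =>
      have i2 := ih (j + 2) (by omega)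
      have i1 := ih (j + 1) (by omega)
      have i0 := ih j (by omega)
      match j with
      | 0 => simp [ph]; ring
      | (j + 1) =>
      rw [show j + 1 + 3 + 3 = (j + 3) + 4 by ring]
      rw [show j + 1 + 2 + 3 = j + 3 + 2 + 1 by ring] at i2
      rw [show j + 1 + 1 + 3 = j + 3 + 2 by ring] at i1
      rw [show j + 1 + 3 = j + 3 + 1 by ring] at i0
      have i00 := ih j (by omega)
      rw [ph_four (x*T) (y*T) (z*T) (j+3), ph_four x y z (j+3), i1, i0, i00]
      ring

lemma ph_mem (φ : Filt R) {x y z : R} (hx : x ∈ φ.W 1) (hy : y ∈ φ.W 1) (hz : z ∈ φ.W 1) (j : ℕ) :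
    ph x y z (j + 3) ∈ φ.W j := by
  have hw : x + y + z ∈ φ.W 1 := add_mem (add_mem hx hy) hz
  have e2 : x * y + x * z + y * z + (x + y + z) ^ 2 ∈ φ.W 2 := by
    refine add_mem (add_mem (add_mem (φ.mul hx hy) (φ.mul hx hz)) (φ.mul hy hz)) ?_
    simpa using φ.pow hw 2
  have e3 : (x + y) * (x + z) * (y + z) ∈ φ.W 3 :=
    φ.mul (φ.mul (add_mem hx hy) (add_mem hx hz)) (add_mem hy hz)
  have e4 : x * y * z * (x + y + z) ∈ φ.W 4 := φ.mul (φ.mul (φ.mul hx hy) hz) hw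
  induction j using Nat.strong_induction_on with
  | _ j ih =>
    match j with
    | 0 => simpa [ph] using φ.one
    | 1 => simp [ph, zero_mem]
    | 2 => simpa [ph] using e2
    | 3 => simpa [ph] using e3
    | (j + 4) =>
      rw [show j + 4 + 3 = (j + 3) + 4 by ring, ph_four]
      have i2 := φ.mul e2 (ih (j + 2) (by omega))
      have i1 := φ.mul e3 (ih (j + 1) (by omega))
      have i0 := φ.mul e4 (ih j (by omega))
      refine add_mem (add_mem ?_ ?_) ?_
      · convert i2 using 2; ring
      · convert i1 using 2; ring
      · convert i0 using 2; ring
end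
end KW

namespace KW
open Polynomial

lemma exists_bezout {R : Type*} [CommRing R] [IsDomain R] [NormalizedGCDMonoid R] {p q : Polynomial R}
    (hp : p ≠ 0) (h : ∀ c : Polynomial R, c ∣ p → c ∣ q → c.natDegree = 0) :
    ∃ (u v : Polynomial R) (r : R), r ≠ 0 ∧ u * p + v * q = C r := by
  classical
  let K := FractionRing R
  let i := algebraMap R K
  have hinj : Function.Injective i := IsFractionRing.injective R K
  have hcop : IsCoprime (p.map i) (q.map i) := by
    rw [← isRelPrime_iff_isCoprime]
    intro g hg1 hg2
    have hg0 : g ≠ 0 := by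
      rintro rfl
      rw [zero_dvd_iff, Polynomial.map_eq_zero_iff hinj] at hg1
      exact hp hg1
    obtain ⟨b, hb, hbg⟩ := IsLocalization.integerNormalization_spec (nonZeroDivisors R) g
    have hb0 : b ≠ 0 := nonZeroDivisors.ne_zero hb
    set c0 := IsLocalization.integerNormalization (nonZeroDivisors R) g with hc0
    have hbg' : c0.map i = C (i b) * g := by
      rw [hbg, Algebra.smul_def]; rfl
    have hib : IsUnit (C (i b) : Polynomial K) := by
      rw [isUnit_C, isUnit_iff_ne_zero]
      exact (map_ne_zero_iff i hinj).2 hb0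
    have d1 : ∀ s : Polynomial R, g ∣ s.map i → c0.primPart ∣ s := by
      intro s hs
      rw [c0.isPrimitive_primPart.dvd_iff_fraction_map_dvd_fraction_map K]
      have : c0.primPart.map i ∣ c0.map i := Polynomial.map_dvd i c0.primPart_dvd
      refine this.trans ?_
      rw [hbg']
      exact (hib.mul_left_dvd).2 hs
    have h0 := h _ (d1 p hg1) (d1 q hg2)
    rw [natDegree_primPart, ← natDegree_map_eq_of_injective hinj, hbg', natDegree_C_mul ((map_ne_zero_iff i hinj).2 hb0)] at h0
    rw [isUnit_iff_degree_eq_zero, degree_eq_natDegree hg0, h0]; rfl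
  obtain ⟨u, v, huv⟩ := hcop
  obtain ⟨b, hb, hbu⟩ := IsLocalization.integerNormalization_spec (nonZeroDivisors R) u
  obtain ⟨b', hb', hbv⟩ := IsLocalization.integerNormalization_spec (nonZeroDivisors R) v
  refine ⟨C b' * IsLocalization.integerNormalization (nonZeroDivisors R) u, C b * IsLocalization.integerNormalization (nonZeroDivisors R) v, b * b', mul_ne_zero (nonZeroDivisors.ne_zero hb) (nonZeroDivisors.ne_zero hb'), ?_⟩
  apply Polynomial.map_injective i hinj
  rw [Polynomial.map_add, Polynomial.map_mul, Polynomial.map_mul, Polynomial.map_mul, Polynomial.map_mul, hbu, hbv,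
    Algebra.smul_def, Algebra.smul_def]
  simp only [Polynomial.map_C, map_mul, Polynomial.algebraMap_apply]
  change C (i b') * (C (i b) * u) * map i p + C (i b) * (C (i b') * v) * map i q = (Polynomial.mapRingHom i) (C b * C b')
  rw [map_mul]
  simp only [Polynomial.coe_mapRingHom, Polynomial.map_C]
  linear_combination (C (i b) * C (i b')) * huv

lemma bezout0 {K : Type*} [Field K] {p q : MvPolynomial (Fin 2) K} (hp : p ≠ 0)
    (h : ∀ c : MvPolynomial (Fin 2) K, c ∣ p → c ∣ q → c.totalDegree = 0) :
    ∃ u v r : MvPolynomial (Fin 2) K, r ≠ 0 ∧ r.degreeOf 0 = 0 ∧ u * p + v * q = r := by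
  let : StrongNormalizationMonoid (MvPolynomial (Fin 1) K) := UniqueFactorizationMonoid.strongNormalizationMonoid
  let : NormalizedGCDMonoid (MvPolynomial (Fin 1) K) :=
    UniqueFactorizationMonoid.toNormalizedGCDMonoid _
  let e := MvPolynomial.finSuccEquiv K 1
  obtain ⟨u, v, r, hr, huv⟩ := exists_bezout (p := e p) (q := e q) (by simpa using hp) (by
    intro c h1 h2
    have h1' : e.symm c ∣ p := by simpa using map_dvd e.symm h1
    have h2' : e.symm c ∣ q := by simpa using map_dvd e.symm h2
    have h0 := h _ h1' h2'
    have h3 : MvPolynomial.degreeOf 0 (e.symm c) = 0 :=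
      Nat.le_zero.1 ((MvPolynomial.degreeOf_le_totalDegree _ _).trans h0.le)
    rw [← MvPolynomial.natDegree_finSuccEquiv] at h3
    simpa [e] using h3)
  refine ⟨e.symm u, e.symm v, e.symm (C r), ?_, ?_, ?_⟩
  · simpa using hr
  · rw [← MvPolynomial.natDegree_finSuccEquiv]
    change (e (e.symm (C r))).natDegree = 0
    simp
  · rw [← huv]; simp

lemma bezout1 {K : Type*} [Field K] {p q : MvPolynomial (Fin 2) K} (hp : p ≠ 0)
    (h : ∀ c : MvPolynomial (Fin 2) K, c ∣ p → c ∣ q → c.totalDegree = 0) (i : Fin 2) :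
    ∃ u v r : MvPolynomial (Fin 2) K, r ≠ 0 ∧ r.degreeOf i = 0 ∧ u * p + v * q = r := by
  let w : Fin 2 ≃ Fin 2 := Equiv.swap 0 i
  let e : MvPolynomial (Fin 2) K ≃ₐ[K] MvPolynomial (Fin 2) K := MvPolynomial.renameEquiv K w
  obtain ⟨u, v, r, hr, hd, huv⟩ := bezout0 (p := e p) (q := e q) (by simpa using hp) (by
    intro c h1 h2
    have h1' : e.symm c ∣ p := by simpa using map_dvd e.symm h1
    have h2' : e.symm c ∣ q := by simpa using map_dvd e.symm h2
    have h0 := h _ h1' h2'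
    rwa [show e.symm c = MvPolynomial.renameEquiv K w.symm c from rfl, MvPolynomial.totalDegree_renameEquiv] at h0)
  refine ⟨e.symm u, e.symm v, e.symm r, by simpa using hr, ?_, ?_⟩
  · rw [show e.symm r = MvPolynomial.rename w.symm r from rfl, show i = w.symm 0 by simp [w],
      MvPolynomial.degreeOf_rename_of_injective w.symm.injective]
    exact hd
  · rw [← huv]; simp

lemma coprime_transfer {K Ω : Type*} [Field K] [Field Ω] (σ : K →+* Ω) {p q : MvPolynomial (Fin 2) K}
    (hp : p ≠ 0)
    (h : ∀ c : MvPolynomial (Fin 2) K, c ∣ p → c ∣ q → c.totalDegree = 0)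
    (c : MvPolynomial (Fin 2) Ω) (h1 : c ∣ MvPolynomial.map σ p) (h2 : c ∣ MvPolynomial.map σ q) :
    c.totalDegree = 0 := by
  have key : ∀ i, c.degreeOf i = 0 := by
    intro i
    obtain ⟨u, v, r, hr, hd, huv⟩ := bezout1 hp h i
    have h3 : c ∣ MvPolynomial.map σ r := by
      rw [← huv, map_add, map_mul, map_mul]
      exact dvd_add (h1.mul_left _) (h2.mul_left _)
    obtain ⟨g, hg⟩ := h3
    have hr' : MvPolynomial.map σ r ≠ 0 := by
      intro h0
      exact hr (MvPolynomial.map_injective σ σ.injective (by simpa using h0))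
    have hd' : (MvPolynomial.map σ r).degreeOf i = 0 := by
      rw [MvPolynomial.degreeOf, MvPolynomial.degrees_map_of_injective _ σ.injective]
      exact hd
    rw [hg] at hr'
    rw [hg, MvPolynomial.degreeOf_mul_eq (left_ne_zero_of_mul hr') (right_ne_zero_of_mul hr')] at hd'
    omega
  rw [MvPolynomial.totalDegree_eq_zero_iff]
  intro m hm x
  have := (MvPolynomial.degreeOf_le_iff (n := x) (d := 0)).1 (key x).le m hm
  omega

end KW

namespace KW
open Polynomial

section theta
variable {K : Type*} [Field K]

/-- `φ_j(Y, X₀, X₁)` as a polynomial in `Y`. -/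
noncomputable def phY (K : Type*) [Field K] (j : ℕ) : Polynomial (MvPolynomial (Fin 2) K) :=
  ph (R := Polynomial (MvPolynomial (Fin 2) K)) X (C (MvPolynomial.X 0)) (C (MvPolynomial.X 1)) j

/-- `φ_j(1, X₀, X₁)`. -/
noncomputable def Ph (K : Type*) [Field K] (j : ℕ) : MvPolynomial (Fin 2) K :=
  ph (R := MvPolynomial (Fin 2) K) 1 (MvPolynomial.X 0) (MvPolynomial.X 1) j

/-- The polynomial `F = Σ f_j φ_j(Y, X₀, X₁)`. -/
noncomputable def bigF {K : Type*} [Field K] (f : Polynomial K) : Polynomial (MvPolynomial (Fin 2) K) :=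
  f.sum fun j c => C (MvPolynomial.C c) * phY K j

lemma bigF_eq (f : Polynomial K) {N : ℕ} (h : f.natDegree < N) : bigF f =
    ∑ j ∈ Finset.range N, C (MvPolynomial.C (f.coeff j)) * phY K j :=
  Polynomial.sum_over_range' f (by simp) N h

lemma bigF_map {L : Type*} [Field L] (τ : K →+* L) (f : Polynomial K) :
    (bigF f).map (MvPolynomial.map τ) = bigF (f.map τ) := by
  rw [bigF_eq f (Nat.lt_succ_self _), bigF_eq (f.map τ) (N := f.natDegree + 1)
    (by simp), Polynomial.map_sum]
  refine Finset.sum_congr rfl fun j _ => ?_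
  rw [Polynomial.map_mul, phY, ← Polynomial.coe_mapRingHom, map_ph]
  simp [phY]

noncomputable def sigma (K : Type*) [Field K] :
    MvPolynomial (Fin 2) K →+* Polynomial (MvPolynomial (Fin 2) K) :=
  MvPolynomial.eval₂Hom (C.comp MvPolynomial.C) (fun i => C (MvPolynomial.X i) * X)

noncomputable def Theta (K : Type*) [Field K] :
    Polynomial (MvPolynomial (Fin 2) K) →+* Polynomial (MvPolynomial (Fin 2) K) :=
  eval₂RingHom (sigma K) X

lemma sigma_monomial (m : Fin 2 →₀ ℕ) (a : K) :
    sigma K (MvPolynomial.monomial m a) = C (MvPolynomial.monomial m a) * X ^ (m 0 + m 1) := by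
  rw [sigma, MvPolynomial.coe_eval₂Hom, MvPolynomial.eval₂_monomial, Finsupp.prod_fintype _ _ (by simp),
    MvPolynomial.monomial_eq, Finsupp.prod_fintype _ _ (by simp)]
  simp only [Fin.prod_univ_two, map_mul, map_pow, RingHom.comp_apply, mul_pow, pow_add]
  ring

lemma coeff_Theta (p : Polynomial (MvPolynomial (Fin 2) K)) (N : ℕ) (m : Fin 2 →₀ ℕ) :
    MvPolynomial.coeff m ((Theta K p).coeff N) =
      if m 0 + m 1 ≤ N then MvPolynomial.coeff m (p.coeff (N - (m 0 + m 1))) else 0 := by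
  induction p using Polynomial.induction_on' with
  | add p q hp hq =>
    rw [map_add, coeff_add, MvPolynomial.coeff_add, hp, hq]
    split_ifs <;> simp
  | monomial i a =>
    rw [Theta, coe_eval₂RingHom, eval₂_monomial]
    induction a using MvPolynomial.induction_on' with
    | add p q hp hq =>
      rw [map_add, add_mul, coeff_add, MvPolynomial.coeff_add, hp, hq, map_add, coeff_add]
      split_ifs <;> simp
    | monomial u a =>
      rw [sigma_monomial, mul_assoc, ← pow_add, coeff_C_mul_X_pow, coeff_monomial]
      by_cases hm : u = m
      · subst hm
        split_ifs <;> first | rfl | (exfalso; omega) | simp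
      · split_ifs <;> simp [MvPolynomial.coeff_monomial, hm]

lemma Theta_phY (j : ℕ) : Theta K (phY K (j + 3)) = C (Ph K (j + 3)) * X ^ j := by
  rw [phY, map_ph, Ph, map_ph (C : MvPolynomial (Fin 2) K →+* _), ← ph_homog]
  simp [Theta, sigma]

lemma phY_lt {j : ℕ} (h : j < 3) : phY K j = 0 := ph_lt _ _ _ h
lemma Ph_lt {j : ℕ} (h : j < 3) : Ph K j = 0 := ph_lt _ _ _ h

lemma coeff_Theta_bigF (f : Polynomial K) (i : ℕ) :
    (Theta K (bigF f)).coeff i = MvPolynomial.C (f.coeff (i + 3)) * Ph K (i + 3) := by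
  rw [bigF_eq f (N := (f.natDegree + i + 1) + 3) (by omega), map_sum, finsetSum_coeff, add_comm _ 3, Finset.sum_range_add]
  rw [Finset.sum_eq_zero, zero_add, Finset.sum_eq_single i]
  · rw [map_mul, add_comm 3 i, Theta_phY]
    simp [Theta, sigma, mul_assoc]
  · intro j _ hj
    rw [map_mul, add_comm 3 j, Theta_phY]
    simp [Theta, sigma, mul_assoc, coeff_X_pow, Ne.symm hj]
  · intro h; exfalso; apply h; simp
  · intro j hj
    rw [phY_lt (by simpa using hj)]; simp

lemma totalDegree_Theta (p : Polynomial (MvPolynomial (Fin 2) K)) (N : ℕ) :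
    ((Theta K p).coeff N).totalDegree ≤ N := by
  rw [MvPolynomial.totalDegree, Finset.sup_le_iff]
  intro m hm
  rw [Finsupp.sum_fintype _ _ (by simp), Fin.sum_univ_two]
  by_contra hlt
  rw [MvPolynomial.mem_support_iff, coeff_Theta, if_neg (by omega)] at hm
  exact hm rfl

lemma Theta_const (p : Polynomial (MvPolynomial (Fin 2) K)) (h : (Theta K p).natDegree = 0) :
    ∃ a, p = C (MvPolynomial.C a) := by
  refine ⟨MvPolynomial.coeff 0 (p.coeff 0), ?_⟩
  ext i m
  rw [coeff_C]
  have h1 := coeff_Theta p (i + (m 0 + m 1)) m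
  simp only [Nat.le_add_left, if_true, Nat.add_sub_cancel] at h1
  rw [← h1]
  by_cases h0 : i + (m 0 + m 1) = 0
  · have hi : i = 0 := by omega
    have hm : m = 0 := by ext x; fin_cases x <;> simp <;> omega
    subst hi hm
    simpa using h1
  · rw [coeff_eq_zero_of_natDegree_lt (by omega)]
    split_ifs with hi
    · have hm : 0 ≠ m := by rintro rfl; simp at h0; omega
      rw [MvPolynomial.coeff_C, if_neg hm]; simp
    · simp

end theta

section coeffs
variable {K : Type*} [Field K]

lemma totalDegree_le_of_dvd' {p q : MvPolynomial (Fin 2) K} (h : p ∣ q) (hq : q ≠ 0) :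
    p.totalDegree ≤ q.totalDegree := by
  obtain ⟨r, rfl⟩ := h
  rw [MvPolynomial.totalDegree_mul_of_isDomain (left_ne_zero_of_mul hq) (right_ne_zero_of_mul hq)]
  omega

lemma reverse_sep {p q : Polynomial (MvPolynomial (Fin 2) K)} {e : ℕ}
    (hp : ∀ N, (p.coeff N).totalDegree ≤ N)
    (hp0 : p ≠ 0)
    (hps : p.leadingCoeff.totalDegree = p.natDegree)
    (hrel : IsRelPrime p.leadingCoeff q.leadingCoeff)
    (hG : ∀ i, 0 < i → i < e → (p * q).reverse.coeff i = 0) :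
    (∀ i, 0 < i → i < e → p.reverse.coeff i = 0 ∧ q.reverse.coeff i = 0) := by
  intro i
  induction i using Nat.strong_induction_on with
  | _ i ih =>
  intro h0 hi
  have h1 := hG i h0 hi
  rw [reverse_mul_of_domain, coeff_mul] at h1
  have h2 : p.reverse.coeff 0 * q.reverse.coeff i + p.reverse.coeff i * q.reverse.coeff 0 = 0 := by
    rw [← h1]
    rw [← Finset.sum_subset (s₁ := {(0, i), (i, 0)})]
    · rw [Finset.sum_pair]; simp; omega
    · intro x; simp; rintro (rfl | rfl) <;> simp
    · rintro ⟨x, y⟩ hxy hn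
      simp at hxy hn
      rw [(ih x (by omega) (by omega) (by omega)).1, zero_mul]
  rw [coeff_zero_reverse, coeff_zero_reverse] at h2
  have h3 : p.leadingCoeff ∣ p.reverse.coeff i := by
    apply hrel.dvd_of_dvd_mul_right
    exact ⟨-q.reverse.coeff i, by linear_combination h2⟩
  have h4 : p.reverse.coeff i = 0 := by
    by_contra hne
    have h5 := totalDegree_le_of_dvd' h3 hne
    rw [coeff_reverse] at hne h5
    by_cases his : i ≤ p.natDegree
    · rw [revAt_le his] at h5
      have := hp (p.natDegree - i)
      omega
    · rw [revAt_eq_self_of_lt (by omega)] at hne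
      exact hne (coeff_eq_zero_of_natDegree_lt (by omega))
  refine ⟨h4, ?_⟩
  rw [h4, zero_mul, add_zero, mul_eq_zero] at h2
  exact h2.resolve_left (leadingCoeff_ne_zero.2 hp0)

lemma coeff_rev_e {p q : Polynomial (MvPolynomial (Fin 2) K)} {e : ℕ} (he : 0 < e)
    (h : ∀ i, 0 < i → i < e → p.reverse.coeff i = 0 ∧ q.reverse.coeff i = 0) :
    p.leadingCoeff * q.reverse.coeff e + p.reverse.coeff e * q.leadingCoeff = (p * q).reverse.coeff e := by
  rw [reverse_mul_of_domain, coeff_mul]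
  rw [← Finset.sum_subset (s₁ := {(0, e), (e, 0)})]
  · rw [Finset.sum_pair (by intro h'; have h3 := congrArg Prod.fst h'; simp only at h3; omega)]; simp
  · intro x; simp; rintro (rfl | rfl) <;> simp
  · rintro ⟨x, y⟩ hxy hn
    simp at hxy hn
    rw [(h x (by omega) (by omega)).1, zero_mul]

end coeffs
end KW

namespace KW
open Polynomial

section smooth
variable {Ω : Type*} [Field Ω] [CharP Ω 2]

lemma Ph_mul (K : Type*) [Field K] [CharP K 2] (j : ℕ) :
    Ph K j * ((1 + MvPolynomial.X 0) * (1 + MvPolynomial.X 1) * (MvPolynomial.X 0 + MvPolynomial.X 1)) =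
    1 + MvPolynomial.X 0 ^ j + MvPolynomial.X 1 ^ j + (1 + MvPolynomial.X 0 + MvPolynomial.X 1) ^ j := by
  have := ph_mul (R := MvPolynomial (Fin 2) K) 1 (MvPolynomial.X 0) (MvPolynomial.X 1) j
  rw [one_pow] at this
  exact this

/-- restriction to the line `X₀ = 0`. -/
noncomputable def ev0 (Ω : Type*) [Field Ω] : MvPolynomial (Fin 2) Ω →ₐ[Ω] Polynomial Ω :=
  MvPolynomial.aeval ![0, X]

lemma ev0_natDegree (p : MvPolynomial (Fin 2) Ω) : (ev0 Ω p).natDegree ≤ p.totalDegree := by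
  refine (MvPolynomial.aeval_natDegree_le p le_rfl ![0, X] (n := 1) ?_).trans (by simp)
  intro i; fin_cases i <;> simp

lemma add_pow_kappa {R : Type*} [CommRing R] [CharP R 2] (k : ℕ) (a b : R) :
    (a + b) ^ 2 ^ k = a ^ 2 ^ k + b ^ 2 ^ k := add_pow_char_pow ..

lemma ev0_Ph {κ t k : ℕ} (hκ : κ = 2 ^ k) (hk : 1 ≤ k) (ht : t + κ = κ ^ 2 + 1) :
    ev0 Ω (Ph Ω t) * ((X + C 1) * X) ^ (κ + 1) = (X ^ κ + X : Polynomial Ω) ^ (κ + 1) := by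
  have h2 : (2 : Polynomial Ω) = 0 := CharTwo.two_eq_zero
  have h1 := congrArg (ev0 Ω) (Ph_mul Ω t)
  have e0 : ev0 Ω (MvPolynomial.X 0) = 0 := by simp [ev0]
  have e1 : ev0 Ω (MvPolynomial.X 1) = X := by simp [ev0]
  have ht0 : t ≠ 0 := by
    rintro rfl
    have : 2 ^ 1 ≤ 2 ^ k := Nat.pow_le_pow_right (by norm_num) hk
    have : κ < κ ^ 2 + 1 := by nlinarith
    omega
  simp only [map_mul, map_add, map_pow, e0, e1, map_one, zero_pow ht0] at h1
  have q1 : ((X + C 1 : Polynomial Ω)) ^ κ = X ^ κ + 1 := by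
    rw [hκ, add_pow_kappa]; simp
  have q2 : (1 + X : Polynomial Ω) ^ κ = 1 + X ^ κ := by rw [hκ, add_pow_kappa]; simp
  have q3 : (1 + X : Polynomial Ω) ^ (t + κ) = (1 + X ^ (κ ^ 2)) * (1 + X) := by
    rw [ht, pow_succ, pow_two, pow_mul, q2, hκ, add_pow_kappa, ← pow_mul]; simp
  have q4 : (X ^ κ + X : Polynomial Ω) ^ κ = X ^ (κ ^ 2) + X ^ κ := by
    rw [pow_two, pow_mul]; conv_lhs => rw [hκ, add_pow_kappa, ← hκ]
  have q5 : (X : Polynomial Ω) ^ t * X ^ κ = X ^ (κ ^ 2) * X := by rw [← pow_add, ht, pow_succ]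
  rw [pow_add, q2] at q3
  rw [mul_pow, pow_succ, pow_succ, pow_succ, q1, q4, C_1]
  linear_combination (X ^ κ * (1 + X ^ κ)) * h1 + (1 + X ^ κ) * q5 + X ^ κ * q3 + (X ^ κ + X ^ κ * X ^ κ ^ 2 * X) * h2

lemma derivative_kappa {κ k : ℕ} (hκ : κ = 2 ^ k) (hk : 1 ≤ k) :
    derivative (X ^ κ + X : Polynomial Ω) = 1 := by
  have : (κ : Ω) = 0 := by
    rw [CharP.cast_eq_zero_iff Ω 2, hκ]; exact dvd_pow_self 2 (by omega)
  simp [derivative_X_pow, this]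

lemma rm_kappa {κ k : ℕ} (hκ : κ = 2 ^ k) (hk : 1 ≤ k) (β : Ω) :
    (X ^ κ + X : Polynomial Ω).rootMultiplicity β ≤ 1 := by
  have hs : (X ^ κ + X : Polynomial Ω).Separable := by
    rw [Polynomial.separable_def, derivative_kappa hκ hk]
    exact isCoprime_one_right
  exact rootMultiplicity_le_one_of_separable hs β

lemma kappa_ne {κ k : ℕ} (hκ : κ = 2 ^ k) (hk : 1 ≤ k) : (X ^ κ + X : Polynomial Ω) ≠ 0 := by
  intro h
  have := derivative_kappa (Ω := Ω) hκ hk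
  rw [h] at this; simp at this

lemma two_le_kappa {κ k : ℕ} (hκ : κ = 2 ^ k) (hk : 1 ≤ k) : 2 ≤ κ := by
  rw [hκ]; calc 2 = 2 ^ 1 := rfl
    _ ≤ 2 ^ k := Nat.pow_le_pow_right (by norm_num) hk

lemma ev0_Ph_natDegree {κ t k : ℕ} (hκ : κ = 2 ^ k) (hk : 1 ≤ k) (ht : t + κ = κ ^ 2 + 1) :
    ev0 Ω (Ph Ω t) ≠ 0 ∧ (ev0 Ω (Ph Ω t)).natDegree + 3 = t := by
  have h1 := ev0_Ph (Ω := Ω) hκ hk ht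
  have hne : ((X ^ κ + X : Polynomial Ω)) ^ (κ + 1) ≠ 0 := pow_ne_zero _ (kappa_ne hκ hk)
  have h0 : ev0 Ω (Ph Ω t) ≠ 0 := by
    intro h; rw [h, zero_mul] at h1; exact hne h1.symm
  have hκ2 := two_le_kappa hκ hk
  refine ⟨h0, ?_⟩
  have h3 := congrArg natDegree h1
  have hx : (X + C 1 : Polynomial Ω) * X ≠ 0 := mul_ne_zero (X_add_C_ne_zero 1) X_ne_zero
  have hd : (X ^ κ + X : Polynomial Ω).natDegree = κ := by
    rw [natDegree_add_eq_left_of_natDegree_lt] <;> simp <;> omega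
  rw [natDegree_mul h0 (pow_ne_zero _ hx), natDegree_pow, natDegree_pow, hd,
    natDegree_mul (X_add_C_ne_zero 1) X_ne_zero, natDegree_X_add_C, natDegree_X] at h3
  nlinarith

lemma rm_pow {p : Polynomial Ω} (hp : p ≠ 0) (n : ℕ) (β : Ω) :
    rootMultiplicity β (p ^ n) = n * rootMultiplicity β p := by
  induction n with
  | zero => simp [rootMultiplicity_eq_zero]
  | succ n ih =>
    rw [pow_succ, rootMultiplicity_mul (mul_ne_zero (pow_ne_zero _ hp) hp), ih]; ring

lemma ev0_rm {κ t k : ℕ} (hκ : κ = 2 ^ k) (hk : 1 ≤ k) (ht : t + κ = κ ^ 2 + 1) (β : Ω) :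
    (ev0 Ω (Ph Ω t)).rootMultiplicity β ≤ κ + 1 := by
  have h1 := ev0_Ph (Ω := Ω) hκ hk ht
  have hne : ((X ^ κ + X : Polynomial Ω)) ^ (κ + 1) ≠ 0 := pow_ne_zero _ (kappa_ne hκ hk)
  have h3 := congrArg (rootMultiplicity β) h1
  rw [rootMultiplicity_mul (by rw [h1]; exact hne), rm_pow (kappa_ne hκ hk)] at h3
  have := rm_kappa (Ω := Ω) hκ hk β
  nlinarith

lemma ev0_root {κ t k : ℕ} (hκ : κ = 2 ^ k) (hk : 1 ≤ k) (ht : t + κ = κ ^ 2 + 1) {β : Ω}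
    (hβ : (ev0 Ω (Ph Ω t)).eval β = 0) : β ^ κ = β ∧ β ≠ 0 ∧ β ≠ 1 := by
  have h1 := ev0_Ph (Ω := Ω) hκ hk ht
  have hne : ((X ^ κ + X : Polynomial Ω)) ^ (κ + 1) ≠ 0 := pow_ne_zero _ (kappa_ne hκ hk)
  constructor
  · have h2 := congrArg (eval β) h1
    simp only [eval_mul, hβ, zero_mul, eval_pow, eval_add, eval_X] at h2
    have h3 := eq_zero_of_pow_eq_zero h2.symm
    rwa [CharTwo.add_eq_zero] at h3
  · have h0 := (ev0_Ph_natDegree (Ω := Ω) hκ hk ht).1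
    have hpos := (rootMultiplicity_pos h0).2 hβ
    have h3 := congrArg (rootMultiplicity β) h1
    have hx : (X + C 1 : Polynomial Ω) * X ≠ 0 := mul_ne_zero (X_add_C_ne_zero 1) X_ne_zero
    rw [rootMultiplicity_mul (by rw [h1]; exact hne), rm_pow (kappa_ne hκ hk), rm_pow hx] at h3
    have h4 := rm_kappa (Ω := Ω) hκ hk β
    have h5 : ¬ ((X + C 1 : Polynomial Ω) * X).IsRoot β := by
      intro h
      have := (rootMultiplicity_pos hx).2 h
      nlinarith
    simp only [IsRoot, eval_mul, eval_add, eval_X, eval_C, mul_eq_zero, not_or] at h5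
    refine ⟨h5.2, ?_⟩
    rintro rfl
    exact h5.1 (CharTwo.add_self_eq_zero _)

lemma t_odd {κ t k : ℕ} (hκ : κ = 2 ^ k) (hk : 1 ≤ k) (ht : t + κ = κ ^ 2 + 1) : t % 2 = 1 ∧ 3 ≤ t := by
  have h2 := two_le_kappa hκ hk
  have : κ % 2 = 0 := by rw [hκ]; exact Nat.mod_eq_zero_of_dvd (dvd_pow_self 2 (by omega))
  obtain ⟨c, rfl⟩ : ∃ c, κ = 2 * c := ⟨κ / 2, by omega⟩
  constructor
  · have : t + 2 * c = 2 * (2 * c * c) + 1 := by rw [ht]; ring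
    omega
  · nlinarith

lemma smooth {κ t k : ℕ} (hκ : κ = 2 ^ k) (hk : 1 ≤ k) (ht : t + κ = κ ^ 2 + 1) {p q : MvPolynomial (Fin 2) Ω}
    (hpq : p * q = Ph Ω t) {β : Ω} (h1 : (ev0 Ω p).eval β = 0) (h2 : (ev0 Ω q).eval β = 0) : False := by
  have hβ : β ≠ 1 := (ev0_root hκ hk ht (β := β) (by rw [← hpq, map_mul, eval_mul, h1, zero_mul])).2.2
  let ρ : MvPolynomial (Fin 2) Ω →ₐ[Ω] Polynomial Ω := MvPolynomial.aeval ![X, C β]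
  have hρ : ∀ r : MvPolynomial (Fin 2) Ω, (ρ r).eval 0 = (ev0 Ω r).eval β := by
    intro r
    have : (evalRingHom (0 : Ω)).comp (ρ : MvPolynomial (Fin 2) Ω →+* Polynomial Ω) =
      (evalRingHom β).comp (ev0 Ω : MvPolynomial (Fin 2) Ω →+* Polynomial Ω) := by
      apply MvPolynomial.ringHom_ext
      · intro a
        simp [ρ, ev0, MvPolynomial.aeval_def]
      · intro i; fin_cases i <;> simp [ρ, ev0]
    exact RingHom.congr_fun this r
  have d1 : X ∣ ρ p := by rw [X_dvd_iff, coeff_zero_eq_eval_zero, hρ, h1]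
  have d2 : X ∣ ρ q := by rw [X_dvd_iff, coeff_zero_eq_eval_zero, hρ, h2]
  obtain ⟨w, hw⟩ : X * X ∣ ρ (Ph Ω t) := by rw [← hpq, map_mul]; exact mul_dvd_mul d1 d2
  have h3 := congrArg (fun r => (derivative (ρ r)).eval 0) (Ph_mul Ω t)
  have e0 : ρ (MvPolynomial.X 0) = X := by simp [ρ]
  have e1 : ρ (MvPolynomial.X 1) = C β := by simp [ρ]
  obtain ⟨hodd, h3t⟩ := t_odd hκ hk ht
  have htΩ : (t : Ω) = 1 := by
    rw [← Nat.div_add_mod t 2, hodd]; simp [CharTwo.two_eq_zero]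
  simp only [map_mul, map_add, map_pow, e0, e1, map_one, hw] at h3
  simp [derivative_pow, htΩ, zero_pow (show t - 1 ≠ 0 by omega)] at h3
  have : (1 + β) ^ (t - 1) ≠ 0 := by
    apply pow_ne_zero
    intro h; exact hβ (CharTwo.add_eq_zero.1 h).symm
  exact this h3.symm

lemma natDegree_ev0_dvd {p c : MvPolynomial (Fin 2) Ω} (h : (ev0 Ω p).natDegree = p.totalDegree)
    (h0 : ev0 Ω p ≠ 0) (hc : c ∣ p) : (ev0 Ω c).natDegree = c.totalDegree := by
  obtain ⟨r, rfl⟩ := hc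
  have h0' : c * r ≠ 0 := by rintro h; rw [h] at h0; simp at h0
  rw [map_mul] at h h0
  rw [natDegree_mul (left_ne_zero_of_mul h0) (right_ne_zero_of_mul h0),
    MvPolynomial.totalDegree_mul_of_isDomain (left_ne_zero_of_mul h0') (right_ne_zero_of_mul h0')] at h
  have := ev0_natDegree c
  have := ev0_natDegree r
  omega

lemma relprime [IsAlgClosed Ω] {κ t k : ℕ} (hκ : κ = 2 ^ k) (hk : 1 ≤ k) (ht : t + κ = κ ^ 2 + 1)
    {p q : MvPolynomial (Fin 2) Ω}
    (hpq : p * q = Ph Ω t) (hp : (ev0 Ω p).natDegree = p.totalDegree) : IsRelPrime p q := by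
  intro c h1 h2
  have hΦ := (ev0_Ph_natDegree (Ω := Ω) hκ hk ht).1
  rw [← hpq, map_mul] at hΦ
  have hp0 := left_ne_zero_of_mul hΦ
  have h3 := natDegree_ev0_dvd hp hp0 h1
  have hc0 : ev0 Ω c ≠ 0 := by
    intro h
    obtain ⟨r, rfl⟩ := h1
    rw [map_mul, h, zero_mul] at hp0; exact hp0 rfl
  by_cases hd : (ev0 Ω c).natDegree = 0
  · rw [hd] at h3
    rw [MvPolynomial.isUnit_iff_totalDegree_of_isReduced]
    refine ⟨?_, h3.symm⟩
    rw [isUnit_iff_ne_zero]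
    intro h4
    rw [MvPolynomial.totalDegree_eq_zero_iff_eq_C.1 h3.symm, h4] at hc0
    simp at hc0
  · exfalso
    obtain ⟨β, hβ⟩ := IsAlgClosed.exists_root (ev0 Ω c) (by
      intro h; exact hd (natDegree_eq_of_degree_eq_some h))
    refine smooth hκ hk ht hpq (β := β) ?_ ?_
    · obtain ⟨r, rfl⟩ := h1
      rw [map_mul, eval_mul, hβ, zero_mul]
    · obtain ⟨r, rfl⟩ := h2
      rw [map_mul, eval_mul, hβ, zero_mul]
end smooth
end KW

namespace KW
open Polynomial

section curves
variable {Ω : Type*} [Field Ω] [CharP Ω 2]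

/-- the parametrized curves on the Kasami surface. -/
noncomputable def curve (κ : ℕ) (δ : Ω) : MvPolynomial (Fin 2) Ω →ₐ[Ω] Polynomial Ω :=
  MvPolynomial.aeval ![(1 + X) ^ (κ + 1), (1 + C δ * X) ^ (κ + 1)]

lemma lin_pow {κ k : ℕ} (hκ : κ = 2 ^ k) {γ : Ω} (hγ : γ ^ κ = γ) :
    (1 + C γ * X : Polynomial Ω) ^ κ = 1 + C γ * X ^ κ := by
  conv_lhs => rw [hκ, add_pow_kappa, ← hκ]
  rw [one_pow, mul_pow, ← C_pow, hγ]

lemma lin_pow_succ {κ k : ℕ} (hκ : κ = 2 ^ k) {γ : Ω} (hγ : γ ^ κ = γ) :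
    (1 + C γ * X : Polynomial Ω) ^ (κ + 1) = (1 + C γ * X ^ κ) * (1 + C γ * X) := by
  rw [pow_succ, lin_pow hκ hγ]

lemma lin_pow_three {κ k : ℕ} (hκ : κ = 2 ^ k) {γ : Ω} (hγ : γ ^ κ = γ) :
    (1 + C γ * X : Polynomial Ω) ^ (κ ^ 3 + 1) = (1 + C γ * X ^ (κ ^ 3)) * (1 + C γ * X) := by
  have e : ∀ n : ℕ, (1 + C γ * X ^ n : Polynomial Ω) ^ κ = 1 + C γ * X ^ (n * κ) := by
    intro n
    conv_lhs => rw [hκ, add_pow_kappa, ← hκ]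
    rw [one_pow, mul_pow, ← C_pow, hγ, pow_mul]
  rw [pow_succ, show κ ^ 3 = κ * κ * κ by ring, pow_mul, pow_mul, lin_pow hκ hγ, e, e]

lemma curve_third {κ k : ℕ} (hκ : κ = 2 ^ k) {δ : Ω} (hδ : δ ^ κ = δ) :
    1 + (1 + X : Polynomial Ω) ^ (κ + 1) + (1 + C δ * X) ^ (κ + 1) = (1 + C (1 + δ) * X) ^ (κ + 1) := by
  have h2 : (2 : Polynomial Ω) = 0 := CharTwo.two_eq_zero
  have h1δ : (1 + δ) ^ κ = 1 + δ := by
    conv_lhs => rw [hκ, add_pow_kappa, ← hκ]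
    rw [hδ, one_pow]
  have a1 := lin_pow_succ (Ω := Ω) hκ (γ := 1) (one_pow _)
  rw [C_1, one_mul, one_mul] at a1
  rw [lin_pow_succ hκ hδ, lin_pow_succ hκ h1δ, a1, C_add, C_1]
  linear_combination (1 - C δ * X * X ^ κ) * h2

lemma curve_coeff_one {κ k : ℕ} (hκ : κ = 2 ^ k) (hk : 1 ≤ k) {γ : Ω} (hγ : γ ^ κ = γ) (hγ0 : γ ≠ 0) :
    1 + (1 + C γ * X : Polynomial Ω) ^ (κ + 1) ≠ 0 := by
  intro h
  have h1 := congrArg (fun p => coeff p 1) h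
  have hκ2 := two_le_kappa hκ hk
  rw [lin_pow_succ hκ hγ] at h1
  have : (1 + (1 + C γ * X ^ κ) * (1 + C γ * X) : Polynomial Ω) = C (1 + 1) + C γ * X + C γ * X ^ κ + C (γ * γ) * X ^ (κ + 1) := by
    simp only [C_add, C_mul, C_1]; ring
  rw [this] at h1
  simp [mul_assoc, coeff_X_pow, coeff_X, show (1:ℕ) ≠ κ by omega, coeff_one, show κ ≠ 0 by omega] at h1
  exact hγ0 h1

lemma curve_Ph {κ t k : ℕ} (hκ : κ = 2 ^ k) (hk : 1 ≤ k) (ht : t + κ = κ ^ 2 + 1)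
    {δ : Ω} (hδ : δ ^ κ = δ) (hδ0 : δ ≠ 0) (hδ1 : δ ≠ 1) : curve κ δ (Ph Ω t) = 0 := by
  have h2 : (2 : Polynomial Ω) = 0 := CharTwo.two_eq_zero
  have h := congrArg (curve κ δ) (Ph_mul Ω t)
  have e0 : curve κ δ (MvPolynomial.X 0) = (1 + X) ^ (κ + 1) := by simp [curve]
  have e1 : curve κ δ (MvPolynomial.X 1) = (1 + C δ * X) ^ (κ + 1) := by simp [curve]
  have h1δ : (1 + δ) ^ κ = 1 + δ := by
    conv_lhs => rw [hκ, add_pow_kappa, ← hκ]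
    rw [hδ, one_pow]
  have htt : (κ + 1) * t = κ ^ 3 + 1 := by
    zify at ht ⊢
    rw [show (t : ℤ) = κ ^ 2 + 1 - κ by linarith]; ring
  have b1 := lin_pow_three (Ω := Ω) hκ (γ := 1) (one_pow _)
  rw [C_1, one_mul, one_mul] at b1
  simp only [map_mul, map_add, map_pow, e0, e1, map_one] at h
  have h3 := curve_third hκ hδ
  rw [h3, ← pow_mul, ← pow_mul, ← pow_mul, htt, b1, lin_pow_three hκ hδ, lin_pow_three hκ h1δ] at h
  have hz : (1 + (1 + X ^ κ ^ 3) * (1 + X) + (1 + C δ * X ^ κ ^ 3) * (1 + C δ * X) +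
      (1 + C (1 + δ) * X ^ κ ^ 3) * (1 + C (1 + δ) * X) : Polynomial Ω) = 0 := by
    rw [C_add, C_1]
    linear_combination (2 + X + X ^ κ ^ 3 + X * X ^ κ ^ 3 + C δ * (X + X ^ κ ^ 3 + X * X ^ κ ^ 3) + C δ ^ 2 * X * X ^ κ ^ 3) * h2
  rw [hz] at h
  refine (mul_eq_zero.1 h).resolve_right ?_
  refine mul_ne_zero (mul_ne_zero ?_ ?_) ?_
  · have := curve_coeff_one (Ω := Ω) hκ hk (γ := 1) (one_pow _) one_ne_zero
    rwa [C_1, one_mul] at this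
  · exact curve_coeff_one hκ hk hδ hδ0
  · have := curve_coeff_one hκ hk h1δ (fun h => hδ1 (CharTwo.add_eq_zero.1 h).symm)
    intro h4
    apply this
    rw [← h3]
    linear_combination h4 + h2

lemma curve_eval_one {κ k : ℕ} (hκ : κ = 2 ^ k) {δ β : Ω} (hδ : δ ^ κ = δ)
    (hβ : (1 + δ) ^ 2 = β) (p : MvPolynomial (Fin 2) Ω) :
    (curve κ δ p).eval 1 = (ev0 Ω p).eval β := by
  have h1δ : (1 + δ) ^ κ = 1 + δ := by
    conv_lhs => rw [hκ, add_pow_kappa, ← hκ]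
    rw [hδ, one_pow]
  have h11 : (1 + 1 : Ω) = 0 := CharTwo.add_self_eq_zero 1
  have : (evalRingHom (1 : Ω)).comp (curve κ δ : MvPolynomial (Fin 2) Ω →+* Polynomial Ω) =
      (evalRingHom β).comp (ev0 Ω : MvPolynomial (Fin 2) Ω →+* Polynomial Ω) := by
    apply MvPolynomial.ringHom_ext
    · intro a
      simp [curve, ev0]
    · intro i; fin_cases i
      · simp [curve, ev0, h11]
      · simp [curve, ev0, pow_succ, h1δ, ← hβ]
  exact RingHom.congr_fun this p

/-- the expansion at `(1,1)` in a generic direction. -/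
noncomputable def gen (Ω : Type*) [Field Ω] : MvPolynomial (Fin 2) Ω →+* Polynomial (Polynomial Ω) :=
  MvPolynomial.eval₂Hom (C.comp C) ![1 + X, 1 + C X * X]

lemma gen_natDegree (p : MvPolynomial (Fin 2) Ω) (j : ℕ) : ((gen Ω p).coeff j).natDegree ≤ j := by
  induction p using MvPolynomial.induction_on generalizing j with
  | C a => simp [gen, coeff_C]; split_ifs <;> simp
  | add p q hp hq =>
    rw [map_add, coeff_add]
    exact (natDegree_add_le _ _).trans (max_le (hp j) (hq j))
  | mul_X p i hp =>
    rw [map_mul]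
    have e0 : gen Ω (MvPolynomial.X 0) = 1 + X := by simp [gen]
    have e1 : gen Ω (MvPolynomial.X 1) = 1 + C X * X := by simp [gen]
    have key : ∀ r : Polynomial Ω, r.natDegree ≤ 1 → ((gen Ω p * (1 + C r * X)).coeff j).natDegree ≤ j := by
      intro r hr
      rw [mul_add, mul_one, coeff_add, ← mul_assoc]
      refine (natDegree_add_le _ _).trans (max_le (hp j) ?_)
      cases j with
      | zero => simp
      | succ j =>
        rw [coeff_mul_X, coeff_mul_C]
        exact natDegree_mul_le.trans (add_le_add (hp j) hr)
    fin_cases i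
    · have := key 1 (by simp)
      simpa [e0] using this
    · have := key X (by simp)
      simpa [e1] using this

lemma gen_curve {κ k : ℕ} (hκ : κ = 2 ^ k) {δ : Ω} (hδ : δ ^ κ = δ) (p : MvPolynomial (Fin 2) Ω)
    (j : ℕ) (hj : j < κ) : (curve κ δ p).coeff j = ((gen Ω p).coeff j).eval δ := by
  have h1 := lin_pow_succ (Ω := Ω) hκ (γ := 1) (one_pow _)
  rw [C_1, one_mul, one_mul] at h1
  let I : Ideal (Polynomial Ω) := Ideal.span {X ^ κ}
  let g' : MvPolynomial (Fin 2) Ω →+* Polynomial Ω := (mapRingHom (evalRingHom δ)).comp (gen Ω)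
  have : (Ideal.Quotient.mk I).comp (curve κ δ : MvPolynomial (Fin 2) Ω →+* Polynomial Ω) =
      (Ideal.Quotient.mk I).comp g' := by
    apply MvPolynomial.ringHom_ext
    · intro a
      simp [curve, gen, g']
    · intro i
      simp only [RingHom.comp_apply]
      rw [Ideal.Quotient.eq, Ideal.mem_span_singleton]
      fin_cases i
      · simp [curve, g', gen]
        rw [h1]
        exact ⟨1 + X, by ring⟩
      · simp [curve, g', gen]
        rw [lin_pow_succ hκ hδ]
        exact ⟨C δ * (1 + C δ * X), by ring⟩
  have h3 := RingHom.congr_fun this p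
  simp only [RingHom.comp_apply] at h3
  rw [Ideal.Quotient.eq, Ideal.mem_span_singleton, X_pow_dvd_iff] at h3
  have h4 := h3 j hj
  rw [coeff_sub, sub_eq_zero] at h4
  refine h4.trans ?_
  simp [g']

lemma gen_Ph_d {d : ℕ} (hd : d % 8 = 5) (h : X ^ 3 ∣ gen Ω (Ph Ω d)) : False := by
  have h2 : (2 : Polynomial Ω) = 0 := CharTwo.two_eq_zero
  have h2' : (2 : Polynomial (Polynomial Ω)) = 0 := CharTwo.two_eq_zero
  have e0 : gen Ω (MvPolynomial.X 0) = 1 + X := by simp [gen]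
  have e1 : gen Ω (MvPolynomial.X 1) = 1 + C X * X := by simp [gen]
  have h3 := congrArg (gen Ω) (Ph_mul Ω d)
  simp only [map_mul, map_add, map_pow, e0, e1, map_one] at h3
  have h6 : X ^ 6 ∣ gen Ω (Ph Ω d) * ((1 + (1 + X)) * (1 + (1 + C X * X)) * (1 + X + (1 + C X * X))) := by
    obtain ⟨w, hw⟩ := h
    rw [hw, show (1 + (1 + X) : Polynomial (Polynomial Ω)) = X by linear_combination h2',
      show (1 + (1 + C X * X) : Polynomial (Polynomial Ω)) = C X * X by linear_combination h2',
      show (1 + X + (1 + C X * X) : Polynomial (Polynomial Ω)) = (1 + C X) * X by linear_combination h2']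
    exact ⟨w * C X * (1 + C X), by ring⟩
  rw [h3, X_pow_dvd_iff] at h6
  have h5 := h6 5 (by norm_num)
  have lin : ∀ r : Polynomial Ω, ((1 + C r * X) ^ d).coeff 5 = r ^ 5 * (d.choose 5 : Polynomial Ω) := by
    intro r
    have := coeff_one_add_X_pow (Polynomial Ω) d 5
    have h7 : (1 + C r * X : Polynomial (Polynomial Ω)) ^ d = ((1 + X) ^ d).comp (C r * X) := by simp
    rw [h7, comp_C_mul_X_coeff, this, mul_comm]
  have l1 := lin 1
  rw [C_1, one_mul, one_pow, one_mul] at l1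
  have hch : ((d.choose 5 : ℕ) : Polynomial Ω) = 1 := by
    have : d.choose 5 % 2 = 1 := by
      haveI : Fact (Nat.Prime 2) := ⟨Nat.prime_two⟩
      obtain ⟨c, rfl⟩ : ∃ c, d = 8 * c + 5 := ⟨d / 8, by omega⟩
      have l0 := Choose.choose_modEq_choose_mod_mul_choose_div_nat (p := 2) (n := 8 * c + 5) (k := 5)
      have l1 := Choose.choose_modEq_choose_mod_mul_choose_div_nat (p := 2) (n := 4 * c + 2) (k := 2)
      have l2 := Choose.choose_modEq_choose_mod_mul_choose_div_nat (p := 2) (n := 2 * c + 1) (k := 1)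
      rw [show (8 * c + 5) % 2 = 1 by omega, show (8 * c + 5) / 2 = 4 * c + 2 by omega] at l0
      rw [show (4 * c + 2) % 2 = 0 by omega, show (4 * c + 2) / 2 = 2 * c + 1 by omega] at l1
      rw [show (2 * c + 1) % 2 = 1 by omega, show (2 * c + 1) / 2 = c by omega] at l2
      norm_num at l0 l1 l2
      have := (l0.trans l1)
      rw [Nat.ModEq] at this
      omega
    rw [← Nat.div_add_mod (d.choose 5) 2, this]; simp [h2]
  rw [show (1 + (1 + X) + (1 + C X * X) : Polynomial (Polynomial Ω)) = 1 + C (1 + X) * X by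
    rw [C_add, C_1]; linear_combination h2'] at h5
  rw [coeff_add, coeff_add, coeff_add, lin, lin, l1, hch, coeff_one] at h5
  simp only [mul_one] at h5
  have h8 : (X + X ^ 4 : Polynomial Ω) = 0 := by
    rw [← h5]
    simp
    linear_combination (-(1 + 2 * X + 5 * X ^ 2 + 5 * X ^ 3 + 2 * X ^ 4 + X ^ 5)) * h2
  have h9 := congrArg (fun p => coeff p 1) h8
  simp [coeff_X_pow] at h9
end curves
end KW

namespace KW
open Polynomial

section irr
variable {Ω : Type*} [Field Ω] [CharP Ω 2] [IsAlgClosed Ω]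

lemma gen_div {κ t k : ℕ} (hκ : κ = 2 ^ k) (hk : 2 ≤ k) (ht : t + κ = κ ^ 2 + 1)
    {p q : MvPolynomial (Fin 2) Ω} (hpq : p * q = Ph Ω t) (hs : 2 * κ + 3 ≤ (ev0 Ω p).natDegree) :
    X ^ 3 ∣ gen Ω p := by
  classical
  have hk1 : 1 ≤ k := by omega
  have hΦ := (ev0_Ph_natDegree (Ω := Ω) hκ hk1 ht).1
  have hΦ' := hΦ
  rw [← hpq, map_mul] at hΦ
  have hp0 := left_ne_zero_of_mul hΦ
  have hκ4 : 4 ≤ κ := by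
    rw [hκ]; calc 4 = 2 ^ 2 := rfl
      _ ≤ 2 ^ k := Nat.pow_le_pow_right (by norm_num) hk
  let S := (ev0 Ω p).roots.toFinset
  have hS : 3 ≤ S.card := by
    have h1 : ∑ β ∈ S, (ev0 Ω p).roots.count β = (ev0 Ω p).roots.card := Multiset.toFinset_sum_count_eq _
    have h2 : (ev0 Ω p).roots.card = (ev0 Ω p).natDegree :=
      ((IsAlgClosed.splits (ev0 Ω p)).natDegree_eq_card_roots).symm
    have h3 : ∑ β ∈ S, (ev0 Ω p).roots.count β ≤ S.card • (κ + 1) := by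
      refine Finset.sum_le_card_nsmul _ _ _ fun β _ => ?_
      rw [count_roots]
      refine (rootMultiplicity_le_rootMultiplicity_of_dvd hΦ' ?_ β).trans (ev0_rm hκ hk1 ht β)
      rw [← hpq, map_mul]; exact dvd_mul_right _ _
    rw [h1, h2, smul_eq_mul] at h3
    by_contra hlt
    have : S.card ≤ 2 := by omega
    nlinarith
  let δ : Ω → Ω := fun β => 1 + β ^ 2 ^ (k - 1)
  have hδinj : Function.Injective δ := by
    intro a b hab
    have h1 : a ^ 2 ^ (k - 1) = b ^ 2 ^ (k - 1) := add_left_cancel hab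
    exact iterateFrobenius_inj Ω 2 (k - 1) (by simpa [iterateFrobenius_def] using h1)
  have hcurve : ∀ β ∈ S, (δ β) ^ κ = δ β ∧ curve κ (δ β) p = 0 := by
    intro β hβ
    have hβ0 : (ev0 Ω p).eval β = 0 := by
      have := Multiset.mem_toFinset.1 hβ
      exact (mem_roots'.1 this).2
    have hβ1 : (ev0 Ω (Ph Ω t)).eval β = 0 := by rw [← hpq, map_mul, eval_mul, hβ0, zero_mul]
    obtain ⟨h1, h2, h3⟩ := ev0_root hκ hk1 ht hβ1
    have hhalf : (β ^ 2 ^ (k - 1)) ^ 2 = β := by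
      rw [← pow_mul, ← pow_succ, show k - 1 + 1 = k by omega, ← hκ, h1]
    have hδκ : (δ β) ^ κ = δ β := by
      conv_lhs => rw [hκ]; simp only [δ]; rw [add_pow_kappa, ← hκ, ← pow_mul, mul_comm, pow_mul, h1, one_pow]
    have hδ2 : (1 + δ β) ^ 2 = β := by
      have : (1 + δ β) = β ^ 2 ^ (k - 1) := by
        simp only [δ]; rw [← add_assoc, CharTwo.add_self_eq_zero, zero_add]
      rw [this, hhalf]
    have hδ0 : δ β ≠ 0 := by
      intro h; rw [h] at hδ2; apply h3; rw [← hδ2]; simp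
    have hδ1 : δ β ≠ 1 := by
      intro h; rw [h, CharTwo.add_self_eq_zero] at hδ2; apply h2; rw [← hδ2]; simp
    refine ⟨hδκ, ?_⟩
    have h4 := curve_Ph hκ hk1 ht hδκ hδ0 hδ1
    rw [← hpq, map_mul] at h4
    refine (mul_eq_zero.1 h4).resolve_right ?_
    intro h5
    have h6 := curve_eval_one hκ hδκ hδ2 q
    rw [h5, eval_zero] at h6
    exact smooth hκ hk1 ht hpq hβ0 h6.symm
  rw [X_pow_dvd_iff]
  intro j hj
  apply eq_zero_of_natDegree_lt_card_of_eval_eq_zero' _ (S.image δ)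
  · intro y hy
    obtain ⟨β, hβ, rfl⟩ := Finset.mem_image.1 hy
    obtain ⟨h1, h2⟩ := hcurve β hβ
    rw [← gen_curve hκ h1 p j (by omega), h2, coeff_zero]
  · rw [Finset.card_image_of_injective _ hδinj]
    have := gen_natDegree p j
    omega

theorem irr {κ t k d : ℕ} (hκ : κ = 2 ^ k) (hk : 2 ≤ k) (ht : t + κ = κ ^ 2 + 1)
    (hd8 : d % 8 = 5) (he : d + 2 * κ + 3 ≤ t) {f : Polynomial Ω} (hft : f.coeff t = 1) (hfd : f.natDegree = t)
    (hgap : ∀ i, d < i → i < t → f.coeff i = 0) (hd0 : f.coeff d ≠ 0)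
    (hcop : ∀ c, c ∣ Ph Ω t → c ∣ Ph Ω d → c.totalDegree = 0) : Irreducible (bigF f) := by
  have hk1 : 1 ≤ k := by omega
  have hκ2 := two_le_kappa hκ hk1
  have hΦ := (ev0_Ph_natDegree (Ω := Ω) hκ hk1 ht)
  have hΦ0 : Ph Ω t ≠ 0 := by intro h; rw [h] at hΦ; simp at hΦ
  have hGd : (Theta Ω (bigF f)).natDegree = t - 3 := by
    apply natDegree_eq_of_le_of_coeff_ne_zero
    · rw [natDegree_le_iff_coeff_eq_zero]
      intro i hi
      rw [coeff_Theta_bigF, coeff_eq_zero_of_natDegree_lt (by omega)]; simp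
    · rw [coeff_Theta_bigF, show t - 3 + 3 = t by omega, hft]; simpa using hΦ0
  have hGl : (Theta Ω (bigF f)).leadingCoeff = Ph Ω t := by
    rw [leadingCoeff, hGd, coeff_Theta_bigF, show t - 3 + 3 = t by omega, hft]; simp
  have hG0 : Theta Ω (bigF f) ≠ 0 := by
    intro h; rw [h, leadingCoeff_zero] at hGl; exact hΦ0 hGl.symm
  -- a factor whose transform has degree zero is a unit
  have hunit : ∀ P Q, bigF f = P * Q → (Theta Ω P).natDegree = 0 → IsUnit P := by
    intro P Q hPQ h0
    obtain ⟨a, rfl⟩ := Theta_const P h0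
    have : a ≠ 0 := by
      rintro rfl
      apply hG0; rw [hPQ]; simp
    rw [Polynomial.isUnit_C]
    exact (isUnit_iff_ne_zero.2 this).map MvPolynomial.C
  -- main facts
  have main : ∀ P Q, bigF f = P * Q →
      (ev0 Ω (Theta Ω P).leadingCoeff).natDegree = (Theta Ω P).natDegree ∧
      (Theta Ω P).leadingCoeff.totalDegree = (Theta Ω P).natDegree := by
    intro P Q hPQ
    rw [hPQ, map_mul, natDegree_mul'] at hGd
    · rw [hPQ, map_mul, leadingCoeff_mul] at hGl
      have h1 := hΦ
      rw [← hGl, map_mul, natDegree_mul (left_ne_zero_of_mul (by rw [← map_mul, hGl]; exact hΦ.1)) (right_ne_zero_of_mul (by rw [← map_mul, hGl]; exact hΦ.1))] at h1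
      have a1 := ev0_natDegree (Theta Ω P).leadingCoeff
      have a2 := ev0_natDegree (Theta Ω Q).leadingCoeff
      have b1 := totalDegree_Theta P (Theta Ω P).natDegree
      have b2 := totalDegree_Theta Q (Theta Ω Q).natDegree
      change (Theta Ω P).leadingCoeff.totalDegree ≤ _ at b1
      change (Theta Ω Q).leadingCoeff.totalDegree ≤ _ at b2
      omega
    · rw [← leadingCoeff_mul, ← map_mul, ← hPQ, hGl]; exact hΦ0
  have hGe : (Theta Ω (bigF f)).reverse.coeff (t - d) = MvPolynomial.C (f.coeff d) * Ph Ω d := by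
    rw [coeff_reverse, hGd]
    by_cases hd3 : t - d ≤ t - 3
    · rw [revAt_le hd3, coeff_Theta_bigF, show t - 3 - (t - d) + 3 = d by omega]
    · exfalso; omega
  have hGi : ∀ i, 0 < i → i < t - d → (Theta Ω (bigF f)).reverse.coeff i = 0 := by
    intro i h0 hi
    rw [coeff_reverse, hGd, revAt_le (by omega), coeff_Theta_bigF, hgap _ (by omega) (by omega)]
    simp
  -- the small factor case
  have small : ∀ P Q, bigF f = P * Q → (Theta Ω P).natDegree < t - d → IsUnit P := by
    intro P Q hPQ hs
    apply hunit P Q hPQ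
    obtain ⟨m1, m2⟩ := main P Q hPQ
    have hl : (Theta Ω P).leadingCoeff * (Theta Ω Q).leadingCoeff = Ph Ω t := by
      rw [← leadingCoeff_mul, ← map_mul, ← hPQ, hGl]
    have hrel := relprime hκ hk1 ht hl (by rw [m1, m2])
    have hsep := reverse_sep (e := t - d) (p := Theta Ω P) (q := Theta Ω Q) (totalDegree_Theta P)
      (by intro h; apply hG0; rw [hPQ, map_mul, h, zero_mul]) m2 hrel (by rw [← map_mul, ← hPQ]; exact hGi)
    have hE := coeff_rev_e (by omega) hsep
    rw [← map_mul, ← hPQ, hGe, coeff_reverse (Theta Ω P), revAt_eq_self_of_lt hs,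
      coeff_eq_zero_of_natDegree_lt hs, zero_mul, add_zero] at hE
    rw [← m2]
    apply hcop
    · exact ⟨_, hl.symm⟩
    · refine ⟨(Theta Ω Q).reverse.coeff (t - d) * MvPolynomial.C (f.coeff d)⁻¹, ?_⟩
      rw [← mul_assoc, hE, mul_comm, ← mul_assoc, ← map_mul, inv_mul_cancel₀ hd0]; simp
  refine ⟨?_, ?_⟩
  · intro hu
    have h1 := natDegree_eq_zero_of_isUnit (hu.map (Theta Ω))
    omega
  · intro P Q hPQ
    by_cases hs : (Theta Ω P).natDegree < t - d
    · exact Or.inl (small P Q hPQ hs)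
    by_cases hr : (Theta Ω Q).natDegree < t - d
    · exact Or.inr (small Q P (by rw [hPQ, mul_comm]) hr)
    exfalso
    obtain ⟨m1, m2⟩ := main P Q hPQ
    obtain ⟨n1, n2⟩ := main Q P (by rw [hPQ, mul_comm])
    have hl : (Theta Ω P).leadingCoeff * (Theta Ω Q).leadingCoeff = Ph Ω t := by
      rw [← leadingCoeff_mul, ← map_mul, ← hPQ, hGl]
    have hrel := relprime hκ hk1 ht hl (by rw [m1, m2])
    have hsep := reverse_sep (e := t - d) (p := Theta Ω P) (q := Theta Ω Q) (totalDegree_Theta P)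
      (by intro h; apply hG0; rw [hPQ, map_mul, h, zero_mul]) m2 hrel (by rw [← map_mul, ← hPQ]; exact hGi)
    have hE := coeff_rev_e (by omega) hsep
    rw [← map_mul, ← hPQ, hGe] at hE
    have g1 := gen_div hκ hk ht hl (by rw [m1]; omega)
    have g2 := gen_div hκ hk ht (p := (Theta Ω Q).leadingCoeff) (q := (Theta Ω P).leadingCoeff)
      (by rw [mul_comm]; exact hl) (by rw [n1]; omega)
    refine gen_Ph_d (Ω := Ω) hd8 ?_
    have h5 : Ph Ω d = MvPolynomial.C (f.coeff d)⁻¹ * (MvPolynomial.C (f.coeff d) * Ph Ω d) := by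
      rw [← mul_assoc, ← map_mul, inv_mul_cancel₀ hd0]; simp
    rw [h5, ← hE, map_mul, map_add, map_mul, map_mul]
    exact (dvd_add (g1.mul_right _) (g2.mul_left _)).mul_left _

end irr
end KW

namespace KW
open Polynomial

section asm
variable {K : Type*} [Field K] [CharP K 2]

lemma bigF_hom {S : Type*} [CommRing S] [CharP S 2] (ψ : Polynomial (MvPolynomial (Fin 2) K) →+* S)
    (f : Polynomial K) : ψ (bigF f) * ((ψ X + ψ (C (MvPolynomial.X 0))) * (ψ X + ψ (C (MvPolynomial.X 1))) *
      (ψ (C (MvPolynomial.X 0)) + ψ (C (MvPolynomial.X 1)))) =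
      f.eval₂ (ψ.comp (C.comp MvPolynomial.C)) (ψ X) +
      f.eval₂ (ψ.comp (C.comp MvPolynomial.C)) (ψ (C (MvPolynomial.X 0))) +
      f.eval₂ (ψ.comp (C.comp MvPolynomial.C)) (ψ (C (MvPolynomial.X 1))) +
      f.eval₂ (ψ.comp (C.comp MvPolynomial.C)) (ψ X + ψ (C (MvPolynomial.X 0)) + ψ (C (MvPolynomial.X 1))) := by
  simp only [eval₂_eq_sum_range]
  rw [bigF_eq f (Nat.lt_succ_self _), map_sum, Finset.sum_mul, ← Finset.sum_add_distrib,
    ← Finset.sum_add_distrib, ← Finset.sum_add_distrib]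
  refine Finset.sum_congr rfl fun j _ => ?_
  rw [map_mul, phY, map_ph, mul_assoc, ph_mul]
  simp only [RingHom.comp_apply]
  ring

lemma phY_mem (j : ℕ) : phY K (j + 3) ∈ (filt K).poly.W j := by
  refine ph_mem _ (Filt.X_mem _) (Filt.C_mem _ ?_) (Filt.C_mem _ ?_) j
  · rw [mem_filt]; intro i
    exact (MvPolynomial.degreeOf_le_totalDegree _ _).trans (by rw [MvPolynomial.totalDegree_X])
  · rw [mem_filt]; intro i
    exact (MvPolynomial.degreeOf_le_totalDegree _ _).trans (by rw [MvPolynomial.totalDegree_X])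

lemma bigF_mem {f : Polynomial K} {t : ℕ} (hf : f.natDegree ≤ t) (ht : 3 ≤ t) :
    bigF f ∈ (filt K).poly.W (t - 3) := by
  rw [bigF_eq f (N := t + 1) (by omega)]
  refine sum_mem fun j hj => ?_
  have hj' : j ≤ t := by simpa [Nat.lt_succ_iff] using hj
  by_cases h3 : j < 3
  · rw [phY_lt h3, mul_zero]; exact zero_mem _
  · obtain ⟨i, rfl⟩ : ∃ i, j = i + 3 := ⟨j - 3, by omega⟩
    have h1 : C (MvPolynomial.C (f.coeff (i + 3))) ∈ (filt K).poly.W 0 := by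
      apply Filt.C_mem
      rw [mem_filt]; intro j
      simp
    have := (filt K).poly.mul h1 (phY_mem (K := K) i)
    exact (filt K).poly.mono (by omega) this

lemma X01_ne : (MvPolynomial.X 0 + MvPolynomial.X 1 : MvPolynomial (Fin 2) K) ≠ 0 := by
  intro h
  have := congrArg (MvPolynomial.eval ![(1 : K), 0]) h
  simp at this

lemma phY_monic {t : ℕ} (ht : 3 ≤ t) (hodd : t % 2 = 1) :
    (phY K t).natDegree = t - 3 ∧ (phY K t).Monic := by
  set a : MvPolynomial (Fin 2) K := MvPolynomial.X 0 with ha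
  set b : MvPolynomial (Fin 2) K := MvPolynomial.X 1 with hb
  have hc0 : a + b ≠ 0 := X01_ne
  have h1 := ph_mul (R := Polynomial (MvPolynomial (Fin 2) K)) X (C a) (C b) t
  change phY K t * _ = _ at h1
  have hR : (X ^ t + C a ^ t + C b ^ t + (X + C a + C b) ^ t : Polynomial (MvPolynomial (Fin 2) K)) =
      X ^ t + C (a ^ t + b ^ t) + (X + C (a + b)) ^ t := by
    simp only [C_add, C_pow]; ring
  rw [hR] at h1
  have htA : (t : MvPolynomial (Fin 2) K) = 1 := by
    rw [← Nat.div_add_mod t 2, hodd]; simp [CharTwo.two_eq_zero]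
  have hcoef : (X ^ t + C (a ^ t + b ^ t) + (X + C (a + b)) ^ t : Polynomial (MvPolynomial (Fin 2) K)).coeff (t - 1) = a + b := by
    rw [coeff_add, coeff_add, coeff_X_add_C_pow, coeff_X_pow, if_neg (by omega), coeff_C, if_neg (by omega),
      show t - (t - 1) = 1 by omega, ← Nat.choose_symm (by omega), show t - (t - 1) = 1 by omega, Nat.choose_one_right, htA]
    ring
  have hnd : (X ^ t + C (a ^ t + b ^ t) + (X + C (a + b)) ^ t : Polynomial (MvPolynomial (Fin 2) K)).natDegree = t - 1 := by
    apply natDegree_eq_of_le_of_coeff_ne_zero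
    · rw [natDegree_le_iff_coeff_eq_zero]
      intro i hi
      have hi0 : i ≠ 0 := by omega
      rw [coeff_add, coeff_add, coeff_X_add_C_pow, coeff_X_pow, coeff_C, if_neg hi0]
      rcases (show i = t ∨ t < i by omega) with rfl | h
      · simp [CharTwo.add_self_eq_zero]
      · rw [if_neg (by omega), Nat.choose_eq_zero_of_lt h]; simp
    · rw [hcoef]; exact hc0
  have hl := congrArg leadingCoeff h1
  have hV : ((X + C a) * (X + C b) * (C a + C b) : Polynomial (MvPolynomial (Fin 2) K)) = ((X + C a) * (X + C b)) * C (a + b) := by rw [C_add]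
  have hm : ((X + C a) * (X + C b) : Polynomial (MvPolynomial (Fin 2) K)).Monic := (monic_X_add_C a).mul (monic_X_add_C b)
  have hlR : (X ^ t + C (a ^ t + b ^ t) + (X + C (a + b)) ^ t : Polynomial (MvPolynomial (Fin 2) K)).leadingCoeff = a + b := by
    rw [leadingCoeff, hnd, hcoef]
  rw [hV, leadingCoeff_mul, leadingCoeff_mul, hm.leadingCoeff, one_mul, leadingCoeff_C, hlR] at hl
  have hmon : (phY K t).Monic := by
    change leadingCoeff _ = 1
    apply mul_right_cancel₀ hc0
    rw [hl, one_mul]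
  refine ⟨?_, hmon⟩
  have hn := congrArg natDegree h1
  rw [hnd, hV, hmon.natDegree_mul', hm.natDegree_mul', natDegree_C, (monic_X_add_C a).natDegree_mul (monic_X_add_C b), natDegree_X_add_C, natDegree_X_add_C] at hn
  · omega
  · rwa [Ne, C_eq_zero]
  · rw [mul_ne_zero_iff]; exact ⟨hm.ne_zero, by rwa [Ne, C_eq_zero]⟩

lemma bigF_natDegree_le {h : Polynomial K} {d : ℕ} (hd : h.natDegree ≤ d) (hd3 : 3 ≤ d) :
    (bigF h).natDegree ≤ d - 3 := by
  rw [natDegree_le_iff_coeff_eq_zero]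
  intro i hi
  exact (((filt K).mem_poly).1 (bigF_mem hd hd3)).2 i hi

lemma bigF_add (f g : Polynomial K) : bigF (f + g) = bigF f + bigF g := by
  rw [bigF, bigF, bigF]
  exact sum_add_index _ _ _ (by simp) (by intros; simp [add_mul])

lemma bigF_X_pow (t : ℕ) : bigF (X ^ t : Polynomial K) = phY K t := by
  rw [bigF, ← monomial_one_right_eq_X_pow, sum_monomial_index] <;> simp

lemma bigF_monic {f h : Polynomial K} {t d : ℕ} (hf : f = X ^ t + h) (hodd : t % 2 = 1)
    (hd : h.natDegree ≤ d) (hd3 : 3 ≤ d) (hdt : d < t) :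
    (bigF f).natDegree = t - 3 ∧ (bigF f).Monic := by
  obtain ⟨h1, h2⟩ := phY_monic (K := K) (t := t) (by omega) hodd
  have h3 := bigF_natDegree_le hd hd3
  have h4 : (bigF h).natDegree < (phY K t).natDegree := by omega
  rw [hf, bigF_add, bigF_X_pow]
  refine ⟨by rw [natDegree_add_eq_left_of_natDegree_lt h4, h1], ?_⟩
  exact h2.add_of_left (degree_lt_degree h4)

lemma bigF_derivative {f h : Polynomial K} {κ k t d : ℕ} (hκ : κ = 2 ^ k) (hk : 2 ≤ k) (ht : t + κ = κ ^ 2 + 1)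
    (hf : f = X ^ t + h)
    (hd : h.natDegree ≤ d) (hd3 : 3 ≤ d) (hdt : d + 2 < t) : derivative (bigF f) ≠ 0 := by
  intro h0
  obtain ⟨hodd, ht3⟩ := t_odd hκ (by omega) ht
  obtain ⟨h1, h2⟩ := bigF_monic hf hodd hd hd3 (by omega)
  set a : MvPolynomial (Fin 2) K := MvPolynomial.X 0 with ha
  set b : MvPolynomial (Fin 2) K := MvPolynomial.X 1 with hb
  have hc0 : a + b ≠ 0 := X01_ne
  have h3 := bigF_hom (RingHom.id (Polynomial (MvPolynomial (Fin 2) K))) f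
  simp only [RingHom.id_apply, RingHom.id_comp] at h3
  have hcst : ∀ c : MvPolynomial (Fin 2) K, eval₂ (C.comp MvPolynomial.C) (C c) f = C (eval₂ MvPolynomial.C c f) := by
    intro c; rw [hom_eval₂]
  rw [← ha, ← hb, hcst, hcst, add_assoc X, ← C_add] at h3
  have hev : ∀ Z : Polynomial (MvPolynomial (Fin 2) K), eval₂ (C.comp MvPolynomial.C) Z f =
      Z ^ t + eval₂ (C.comp MvPolynomial.C) Z h := by
    intro Z; rw [hf, eval₂_add, eval₂_X_pow]
  rw [hev X, hev (X + C (a + b))] at h3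
  have h4 := congrArg (fun p => (derivative p).coeff (t - 3)) h3
  have hz : ∀ Z : Polynomial (MvPolynomial (Fin 2) K), Z.natDegree ≤ 1 →
      (derivative (eval₂ (C.comp MvPolynomial.C) Z h)).coeff (t - 3) = 0 := by
    intro Z hZ
    have : eval₂ (C.comp MvPolynomial.C) Z h = (h.map MvPolynomial.C).comp Z := by
      rw [comp, eval₂_map]
    rw [this, coeff_derivative, coeff_eq_zero_of_natDegree_lt, zero_mul]
    refine natDegree_comp_le.trans_lt ?_
    have := natDegree_map_le (f := (MvPolynomial.C : K →+* MvPolynomial (Fin 2) K)) (p := h)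
    calc _ ≤ d * 1 := Nat.mul_le_mul (this.trans hd) hZ
      _ < _ := by omega
  have htA : (t : MvPolynomial (Fin 2) K) = 1 := by
    rw [← Nat.div_add_mod t 2, hodd]; simp [CharTwo.two_eq_zero]
  have hch : (((t - 1).choose (t - 3) : ℕ) : MvPolynomial (Fin 2) K) = 0 := by
    rw [← Nat.choose_symm (by omega), show t - 1 - (t - 3) = 2 by omega]
    obtain ⟨w, hw⟩ : 4 ∣ κ := by
      rw [hκ]; exact pow_dvd_pow 2 hk
    have h5 : t - 1 = 4 * (w * (4 * w - 1)) := by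
      rcases Nat.eq_zero_or_pos w with rfl | hw0
      · simp at hw; rw [hw] at ht; simp at ht; omega
      · obtain ⟨x, rfl⟩ : ∃ x, w = x + 1 := ⟨w - 1, by omega⟩
        rw [show 4 * (x + 1) - 1 = 4 * x + 3 by omega]
        have : t = 1 + 4 * ((x + 1) * (4 * x + 3)) := by
          zify at ht hw ⊢
          rw [show (t : ℤ) = κ ^ 2 + 1 - κ by linarith, hw]; ring
        omega
    rw [h5, Nat.choose_two_right]
    generalize w * (4 * w - 1) = y
    rw [show 4 * y * (4 * y - 1) = 2 * (2 * (y * (4 * y - 1))) by ring, Nat.mul_div_cancel_left _ (by norm_num)]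
    push_cast
    have h22 : (2 : MvPolynomial (Fin 2) K) = 0 := CharTwo.two_eq_zero
    rw [h22, zero_mul]
  simp only [derivative_add, derivative_C, coeff_add, hz X (by simp), hz (X + C (a + b)) (by rw [natDegree_X_add_C])] at h4
  rw [derivative_mul, h0, zero_mul, zero_add] at h4
  have hV : derivative ((X + C a) * (X + C b) * (C (a + b)) : Polynomial (MvPolynomial (Fin 2) K)) = C ((a + b) * (a + b)) := by
    simp only [derivative_mul, derivative_add, derivative_X, derivative_C, C_add, C_mul]
    have h2 : (2 : Polynomial (MvPolynomial (Fin 2) K)) = 0 := CharTwo.two_eq_zero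
    linear_combination (X * (C a + C b)) * h2
  rw [hV, coeff_mul_C, ← h1, h2.coeff_natDegree, h1, one_mul] at h4
  rw [derivative_X_pow, derivative_pow] at h4
  simp [htA, coeff_X_pow, show t - 3 ≠ t - 1 by omega] at h4
  rw [← C_add, coeff_X_add_C_pow, hch, mul_zero] at h4
  exact hc0 (mul_self_eq_zero.1 h4)
end asm
end KW

namespace KW
open Polynomial

lemma phi_eq {p : MvPolynomial (Fin 2) (ZMod 2)} {j : ℕ}
    (hp : p * ((MvPolynomial.X 0 + MvPolynomial.X 1) * (MvPolynomial.X 0 + 1) * (MvPolynomial.X 1 + 1)) =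
      MvPolynomial.X 0 ^ j + MvPolynomial.X 1 ^ j + 1 + (MvPolynomial.X 0 + MvPolynomial.X 1 + 1) ^ j) :
    p = Ph (ZMod 2) j := by
  have h1 := Ph_mul (ZMod 2) j
  have hV : ((MvPolynomial.X 0 + MvPolynomial.X 1) * (MvPolynomial.X 0 + 1) * (MvPolynomial.X 1 + 1) : MvPolynomial (Fin 2) (ZMod 2)) ≠ 0 := by
    refine mul_ne_zero (mul_ne_zero X01_ne ?_) ?_
    · intro h
      have := congrArg (MvPolynomial.eval ![(0 : ZMod 2), 0]) h
      simp at this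
    · intro h
      have := congrArg (MvPolynomial.eval ![(0 : ZMod 2), 0]) h
      simp at this
  apply mul_right_cancel₀ hV
  rw [hp, show ((MvPolynomial.X 0 + MvPolynomial.X 1) * (MvPolynomial.X 0 + 1) * (MvPolynomial.X 1 + 1) : MvPolynomial (Fin 2) (ZMod 2)) = ((1+MvPolynomial.X 0)*(1+MvPolynomial.X 1)*(MvPolynomial.X 0+MvPolynomial.X 1)) by ring, h1,
    show (MvPolynomial.X 0 + MvPolynomial.X 1 + 1 : MvPolynomial (Fin 2) (ZMod 2)) = 1 + MvPolynomial.X 0 + MvPolynomial.X 1 by ring]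
  ring

lemma map_Ph {K Ω : Type*} [Field K] [Field Ω] (σ : K →+* Ω) (j : ℕ) :
    MvPolynomial.map σ (Ph K j) = Ph Ω j := by
  rw [Ph, Ph, map_ph]; simp

lemma irr_all {Ω : Type*} [Field Ω] [CharP Ω 2] [IsAlgClosed Ω] {κ t k d : ℕ} (hκ : κ = 2 ^ k) (hk : 2 ≤ k)
    (ht : t + κ = κ ^ 2 + 1) (hd8 : d % 8 = 5) (he : d + 2 * κ + 3 ≤ t) {f h : Polynomial Ω}
    (hf : f = X ^ t + h) (hd : h.natDegree = d)
    (hcop : ∀ c, c ∣ Ph (ZMod 2) t → c ∣ Ph (ZMod 2) d → c.totalDegree = 0) : Irreducible (bigF f) := by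
  have hlt : h.degree < (X ^ t : Polynomial Ω).degree := by
    rw [degree_X_pow]
    exact degree_le_natDegree.trans_lt (by rw [hd]; exact_mod_cast (by omega : d < t))
  refine irr hκ hk ht hd8 he ?_ ?_ ?_ ?_ ?_
  · rw [hf, coeff_add, coeff_X_pow, if_pos rfl, coeff_eq_zero_of_natDegree_lt (by omega), add_zero]
  · rw [hf, natDegree_add_eq_left_of_degree_lt hlt, natDegree_X_pow]
  · intro i h1 h2
    rw [hf, coeff_add, coeff_X_pow, if_neg (by omega), coeff_eq_zero_of_natDegree_lt (by omega), add_zero]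
  · rw [hf, coeff_add, coeff_X_pow, if_neg (by omega), zero_add, ← hd]
    change h.leadingCoeff ≠ 0
    rw [Ne, leadingCoeff_eq_zero]
    rintro rfl
    simp at hd
    omega
  · intro c h1 h2
    rw [← map_Ph (ZMod.castHom (dvd_refl 2) Ω)] at h1 h2
    refine coprime_transfer _ ?_ hcop c h1 h2
    intro h0
    have := (ev0_Ph_natDegree (Ω := ZMod 2) hκ (by omega) ht).1
    rw [h0] at this
    simp at this

/-- Bezout data over the base field. -/
lemma base_data {L : Type*} [Field L] [CharP L 2] {κ t k d : ℕ} (hκ : κ = 2 ^ k) (hk : 2 ≤ k)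
    (ht : t + κ = κ ^ 2 + 1) (hd8 : d % 8 = 5) (he : d + 2 * κ + 3 ≤ t) {f h : Polynomial L}
    (hf : f = X ^ t + h) (hd : h.natDegree = d)
    (hcop : ∀ c, c ∣ Ph (ZMod 2) t → c ∣ Ph (ZMod 2) d → c.totalDegree = 0) :
    ∃ u v : Polynomial (MvPolynomial (Fin 2) L), ∃ δ : MvPolynomial (Fin 2) L, δ ≠ 0 ∧
      u * bigF f + v * derivative (bigF f) = C δ ∧
      (MvPolynomial.X 0 + MvPolynomial.X 1) ∣ δ ∧ (bigF f).eval (MvPolynomial.X 0) ∣ δ ∧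
      (bigF f).eval (MvPolynomial.X 1) ∣ δ := by
  have hκ4 : 4 ≤ κ := by
    rw [hκ]; calc 4 = 2 ^ 2 := by norm_num
      _ ≤ _ := Nat.pow_le_pow_right (by norm_num) hk
  obtain ⟨hodd, ht3⟩ := t_odd hκ (by omega) ht
  obtain ⟨hnd, hmon⟩ := bigF_monic hf hodd hd.le (by omega) (by omega)
  have hder := bigF_derivative hκ hk ht hf hd.le (by omega) (by omega)
  have : CharP (AlgebraicClosure L) 2 := charP_of_injective_algebraMap (algebraMap L (AlgebraicClosure L)).injective 2
  set τ := algebraMap L (AlgebraicClosure L) with hτ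
  have hirr : Irreducible (bigF f) := by
    refine hmon.irreducible_of_irreducible_map (MvPolynomial.map τ) _ ?_
    rw [bigF_map]
    refine irr_all (h := h.map τ) hκ hk ht hd8 he ?_ ?_ hcop
    · rw [hf]; simp
    · rw [natDegree_map, hd]
  let : StrongNormalizationMonoid (MvPolynomial (Fin 2) L) := UniqueFactorizationMonoid.strongNormalizationMonoid
  let : NormalizedGCDMonoid (MvPolynomial (Fin 2) L) := UniqueFactorizationMonoid.toNormalizedGCDMonoid _
  obtain ⟨u, v, r, hr, huv⟩ := exists_bezout (p := bigF f) (q := derivative (bigF f)) hmon.ne_zero (by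
    intro c hc1 hc2
    rcases hirr.dvd_iff.1 hc1 with h1 | h1
    · exact natDegree_eq_zero_of_isUnit h1
    · exfalso
      have h2 : bigF f ∣ derivative (bigF f) := h1.dvd.trans hc2
      have h3 := natDegree_le_of_dvd h2 hder
      have h4 := natDegree_derivative_lt (p := bigF f) (by omega)
      omega)
  have hroot : ∀ c, (bigF f).eval c ≠ 0 := by
    intro c hc
    have h1 : (X - C c) ∣ bigF f := dvd_iff_isRoot.2 hc
    rcases hirr.dvd_iff.1 h1 with h2 | h2
    · exact not_isUnit_X_sub_C c h2
    · have h3 := natDegree_le_of_dvd h2.dvd (X_sub_C_ne_zero c)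
      rw [natDegree_X_sub_C] at h3
      omega
  set w := (MvPolynomial.X 0 + MvPolynomial.X 1 : MvPolynomial (Fin 2) L) *
    ((bigF f).eval (MvPolynomial.X 0) * (bigF f).eval (MvPolynomial.X 1)) with hw
  refine ⟨u * C w, v * C w, r * w, mul_ne_zero hr (mul_ne_zero X01_ne (mul_ne_zero (hroot _) (hroot _))), ?_, ?_, ?_, ?_⟩
  · rw [C_mul (a := r), ← huv]; ring
  · exact ⟨r * ((bigF f).eval (MvPolynomial.X 0) * (bigF f).eval (MvPolynomial.X 1)), by rw [hw]; ring⟩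
  · exact ⟨r * ((MvPolynomial.X 0 + MvPolynomial.X 1) * (bigF f).eval (MvPolynomial.X 1)), by rw [hw]; ring⟩
  · exact ⟨r * ((MvPolynomial.X 0 + MvPolynomial.X 1) * (bigF f).eval (MvPolynomial.X 0)), by rw [hw]; ring⟩

lemma eval_dvd_ne {K L : Type*} [Field K] [Field L] (ι : L →+* K) {p δ : MvPolynomial (Fin 2) L} (hp : p ∣ δ)
    {x : Fin 2 → K} (hx : MvPolynomial.eval x (MvPolynomial.map ι δ) ≠ 0) :
    MvPolynomial.eval x (MvPolynomial.map ι p) ≠ 0 := by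
  obtain ⟨q, rfl⟩ := hp
  rw [map_mul, map_mul] at hx
  exact left_ne_zero_of_mul hx

lemma no_zero {K L : Type} [Field K] [Finite K] [Field L] [CharP K 2] [CharP L 2] (ι : L →+* K) {f : Polynomial L}
    {δ : MvPolynomial (Fin 2) L}
    (h1 : (MvPolynomial.X 0 + MvPolynomial.X 1) ∣ δ) (h2 : (bigF f).eval (MvPolynomial.X 0) ∣ δ)
    (h3 : (bigF f).eval (MvPolynomial.X 1) ∣ δ) (hapn : IsAPN (fun x => Polynomial.eval x (f.map ι)))
    (x : Fin 2 → K) (hx : MvPolynomial.eval x (MvPolynomial.map ι δ) ≠ 0) (y : K) :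
    eval₂ (MvPolynomial.eval x) y (bigF (f.map ι)) ≠ 0 := by
  intro h0
  have e1 := eval_dvd_ne ι h1 hx
  simp at e1
  have key : ∀ i, MvPolynomial.eval x (MvPolynomial.map ι ((bigF f).eval (MvPolynomial.X i))) =
      eval₂ (MvPolynomial.eval x) (x i) (bigF (f.map ι)) := by
    intro i
    rw [← bigF_map, eval₂_map]
    rw [← RingHom.comp_apply, eval, hom_eval₂]
    congr 1
    simp
  have e2 := eval_dvd_ne ι h2 hx
  have e3 := eval_dvd_ne ι h3 hx
  rw [key] at e2 e3
  have hy0 : y ≠ x 0 := by rintro rfl; exact e2 h0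
  have hy1 : y ≠ x 1 := by rintro rfl; exact e3 h0
  have hsum := bigF_hom (eval₂RingHom (MvPolynomial.eval x) y) (f.map ι)
  have hcomp : (eval₂RingHom (MvPolynomial.eval x) y).comp (C.comp MvPolynomial.C) = RingHom.id K := by
    ext c; simp
  rw [hcomp] at hsum
  simp only [coe_eval₂RingHom, h0, zero_mul, eval₂_C, eval₂_X, MvPolynomial.eval_X] at hsum
  have hne : x 0 + x 1 ≠ 0 := e1
  have hap := hapn (x 0 + x 1) (eval (x 0) (f.map ι) + eval (x 1) (f.map ι)) hne
  have hsub : ({x 0, x 1, y} : Set K) ⊆ {z | eval (z + (x 0 + x 1)) (f.map ι) + eval z (f.map ι) =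
      eval (x 0) (f.map ι) + eval (x 1) (f.map ι)} := by
    intro z hz
    rcases hz with rfl | rfl | rfl
    · change eval (x 0 + (x 0 + x 1)) (f.map ι) + _ = _
      rw [← add_assoc, CharTwo.add_self_eq_zero, zero_add, add_comm]
    · change eval (x 1 + (x 0 + x 1)) (f.map ι) + _ = _
      rw [add_comm (x 0) (x 1), ← add_assoc, CharTwo.add_self_eq_zero, zero_add]
    · change eval (z + (x 0 + x 1)) (f.map ι) + _ = _
      rw [← add_assoc]
      change 0 = eval z _ + eval (x 0) _ + eval (x 1) _ + eval (z + x 0 + x 1) _ at hsum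
      generalize eval z (f.map ι) = A at *
      generalize eval (x 0) (f.map ι) = B at *
      generalize eval (x 1) (f.map ι) = C' at *
      generalize eval (z + x 0 + x 1) (f.map ι) = D at *
      have h22 : (2 : K) = 0 := CharTwo.two_eq_zero
      linear_combination -hsum - (B + C') * h22
  have hx01 : x 0 ≠ x 1 := by
    intro h; rw [h, CharTwo.add_self_eq_zero] at hne; exact hne rfl
  have hcard : ({x 0, x 1, y} : Set K).ncard = 3 := by
    rw [Set.ncard_eq_three]
    exact ⟨_, _, _, hx01, hy0.symm, hy1.symm, rfl⟩
  have := Set.ncard_le_ncard hsub (Set.toFinite _)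
  rw [hcard] at this
  exact absurd (this.trans hap) (by norm_num)

end KW

namespace KW
open Polynomial

lemma final_step {L K : Type} [Field L] [CharP L 2] [Field K] [CharP K 2] [Fintype K] (ι : L →+* K)
    {κ t k d : ℕ} (hκ : κ = 2 ^ k) (hk : 2 ≤ k)
    (ht : t + κ = κ ^ 2 + 1) (hd8 : d % 8 = 5) (he : d + 2 * κ + 3 ≤ t) {f h : Polynomial L}
    (hf : f = X ^ t + h) (hd : h.natDegree = d)
    (hcop : ∀ c, c ∣ Ph (ZMod 2) t → c ∣ Ph (ZMod 2) d → c.totalDegree = 0)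
    {u v : Polynomial (MvPolynomial (Fin 2) L)} {δ : MvPolynomial (Fin 2) L} (hδ : δ ≠ 0)
    (huv : u * bigF f + v * derivative (bigF f) = C δ)
    (h1 : (MvPolynomial.X 0 + MvPolynomial.X 1) ∣ δ) (h2 : (bigF f).eval (MvPolynomial.X 0) ∣ δ)
    (h3 : (bigF f).eval (MvPolynomial.X 1) ∣ δ) (hapn : IsAPN (fun x => Polynomial.eval x (f.map ι)))
    {D μ j : ℕ} (hD : D + 2 = t - 3)
    (hμ : 16 * (D + 2) ^ 2 ≤ 2 ^ μ) (hj1 : (D + 2) * (2 ^ μ + 2 * (D + 2)) < 2 ^ j)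
    (hj2 : 2 ^ μ + D + 2 + δ.totalDegree < 2 ^ j) (hq : Fintype.card K = 2 ^ (μ + j)) : False := by
  have hκ4 : 4 ≤ κ := by
    rw [hκ]; calc 4 = 2 ^ 2 := by norm_num
      _ ≤ _ := Nat.pow_le_pow_right (by norm_num) hk
  obtain ⟨hodd, ht3⟩ := t_odd hκ (by omega) ht
  have hfK : f.map ι = X ^ t + h.map ι := by rw [hf]; simp
  have hdK : (h.map ι).natDegree = d := by rw [natDegree_map, hd]
  obtain ⟨hnd, hmon⟩ := bigF_monic hfK hodd hdK.le (by omega) (by omega)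
  have : CharP (AlgebraicClosure K) 2 := charP_of_injective_algebraMap (algebraMap K (AlgebraicClosure K)).injective 2
  set τ := algebraMap K (AlgebraicClosure K) with hτ
  have hinj : Function.Injective (MvPolynomial.map (σ := Fin 2) ι) := MvPolynomial.map_injective ι ι.injective
  have hft : (f.map ι).natDegree ≤ t := by
    rw [hfK]
    refine (natDegree_add_le _ _).trans ?_
    rw [natDegree_X_pow, hdK]
    exact max_le le_rfl (by omega)
  refine stepanov τ (F := bigF (f.map ι)) (u := u.map (MvPolynomial.map ι)) (v := v.map (MvPolynomial.map ι))
    (δ := MvPolynomial.map ι δ) (D := D) (E := δ.totalDegree) (μ := μ) (j := j) hmon (by omega) ?_ ?_ ?_ ?_ ?_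
    hμ hj1 hj2 hq ?_
  · rw [hD]; exact bigF_mem hft (by omega)
  · rw [bigF_map]
    refine irr_all (h := (h.map ι).map τ) hκ hk ht hd8 he ?_ ?_ hcop
    · rw [hfK]; simp
    · rw [natDegree_map, hdK]
  · intro h0
    exact hδ (hinj (by rw [h0, map_zero]))
  · rw [mem_filt]
    intro i
    refine le_trans ?_ (MvPolynomial.degreeOf_le_totalDegree δ i)
    classical
    rw [MvPolynomial.degreeOf_def, MvPolynomial.degreeOf_def]
    exact Multiset.count_le_of_le i MvPolynomial.degrees_map_le
  · have := congrArg (Polynomial.map (MvPolynomial.map ι)) huv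
    rw [Polynomial.map_add, Polynomial.map_mul, Polynomial.map_mul, ← derivative_map, bigF_map, map_C] at this
    exact this
  · exact no_zero ι h1 h2 h3 hapn

lemma nat_setup {k t d : ℕ} (hk : 2 ≤ k) (ht : t = 2 ^ (2 * k) - 2 ^ k + 1)
    (hdlt : d < 2 ^ (2 * k) - 3 * 2 ^ k - 1) :
    t + 2 ^ k = (2 ^ k) ^ 2 + 1 ∧ d + 2 * 2 ^ k + 3 ≤ t := by
  rw [mul_comm 2 k, pow_mul] at ht hdlt
  have : 2 ^ k ≤ (2 ^ k) ^ 2 := Nat.le_self_pow (by norm_num) _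
  omega

end KW

open MvPolynomial

/-- Let `L = F_{2^n}`, `t = 2^(2k) - 2^k + 1` (k ≥ 2) the Kasami–Welch number, and
`f(x) = x^t + h(x) ∈ L[x]` with `3 ≤ d = deg h`, `d ≡ 5 (mod 8)` and `d < 2^(2k) - 3·2^k - 1`.
If `φ_t(x,y)` and `φ_d(x,y)` (in `F_2[x,y]`) have no common nonconstant factor, then `f` is not
exceptional APN: there are only finitely many `m ≥ 1` such that `f` is APN on `F_{2^(nm)}`. -/
theorem kasami_plus_5mod8_not_exceptional_APN (n : ℕ) (hn : 1 ≤ n) (k : ℕ) (hk : 2 ≤ k)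
    (t : ℕ) (ht : t = 2 ^ (2 * k) - 2 ^ k + 1)
    (h : Polynomial (GaloisField 2 n)) (d : ℕ) (hd : h.natDegree = d)
    (hd3 : 3 ≤ d) (hdmod : d % 8 = 5) (hdlt : d < 2 ^ (2 * k) - 3 * 2 ^ k - 1)
    (f : Polynomial (GaloisField 2 n)) (hf : f = Polynomial.X ^ t + h)
    (phiT phiD : MvPolynomial (Fin 2) (ZMod 2))
    (hphiT : phiT * ((X 0 + X 1) * (X 0 + 1) * (X 1 + 1)) =
      X 0 ^ t + X 1 ^ t + 1 + (X 0 + X 1 + 1) ^ t)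
    (hphiD : phiD * ((X 0 + X 1) * (X 0 + 1) * (X 1 + 1)) =
      X 0 ^ d + X 1 ^ d + 1 + (X 0 + X 1 + 1) ^ d)
    (hcoprime : ∀ c : MvPolynomial (Fin 2) (ZMod 2), c ∣ phiT → c ∣ phiD → c.totalDegree = 0) :
    {m : ℕ | 1 ≤ m ∧ ∀ ι : GaloisField 2 n →+* GaloisField 2 (n * m),
      IsAPN (fun x => Polynomial.eval x (f.map ι))}.Finite := by
  obtain ⟨ht', he⟩ := KW.nat_setup hk ht hdlt
  have hT := KW.phi_eq hphiT
  have hD := KW.phi_eq hphiD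
  rw [hT, hD] at hcoprime
  obtain ⟨u, v, δ, hδ, huv, h1, h2, h3⟩ := KW.base_data rfl hk ht' hdmod he hf hd hcoprime
  obtain ⟨D, hDt⟩ : ∃ D, D + 2 = t - 3 := ⟨t - 5, by omega⟩
  obtain ⟨μ, hμ⟩ : ∃ μ, 16 * (D + 2) ^ 2 ≤ 2 ^ μ := ⟨_, Nat.lt_two_pow_self.le⟩
  set j0 := (D + 2) * (2 ^ μ + 2 * (D + 2)) + (2 ^ μ + D + 2 + δ.totalDegree) with hj0
  refine (Set.finite_Iio (μ + j0)).subset ?_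
  rintro m ⟨hm1, hm⟩
  by_contra hlt
  have hm2 : μ + j0 ≤ m := by simpa using hlt
  have hm3 : m ≤ n * m := Nat.le_mul_of_pos_left m hn
  have hnm : n * m ≠ 0 := by
    have := Nat.mul_pos (show 0 < n by omega) (show 0 < m by omega)
    omega
  obtain ⟨j, hj⟩ : ∃ j, n * m = μ + j := ⟨n * m - μ, by omega⟩
  have hjlt : j < 2 ^ j := Nat.lt_two_pow_self
  have hjge : j0 ≤ j := by omega
  obtain ⟨ι⟩ : Nonempty (GaloisField 2 n →+* GaloisField 2 (n * m)) := by
    have : Nonempty (GaloisField 2 n →ₐ[ZMod 2] GaloisField 2 (n * m)) := by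
      apply FiniteField.nonempty_algHom_of_finrank_dvd
      rw [GaloisField.finrank 2 (by omega), GaloisField.finrank 2 hnm]
      exact dvd_mul_right n m
    exact this.map fun a => a.toRingHom
  have : Fintype (GaloisField 2 (n * m)) := Fintype.ofFinite _
  have hq : Fintype.card (GaloisField 2 (n * m)) = 2 ^ (μ + j) := by
    rw [← Nat.card_eq_fintype_card, GaloisField.card 2 _ hnm, hj]
  exact KW.final_step ι rfl hk ht' hdmod he hf hd hcoprime hδ huv h1 h2 h3 (hm ι) hDt hμ
    (by omega) (by omega) hq
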